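/- arXiv:1805.02521 — 2 statements merged into one kernel-verified Lean document; each statement's English description precedes it below -/
import Mathlib

section
/- Dimensional crossover, part (i) (Theorem 1.2(i)): for every p ∈ (4,6) and μ > 0, a ground state of mass μ on the grid 𝒢 exists if and only if μ ≥ μ_p; in particular, at the critical mass μ = μ_p a ground state exists and has zero energy. -/
/- Formalization of NLS ground states on the two-dimensional grid 𝒢
   (the planar metric graph with vertex set ℤ×ℤ and unit edges).

   A function `u` on 𝒢 is encoded by the family `h j` of its restrictions to
   the horizontal lines `H j` and the family `w k` of its restrictions to the
   vertical lines `V k`, subject to the vertex-compatibility conditions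
   `h j k = w k j`.  The (weak) derivative of `u` along each line is carried
   as additional data `hd`, `wd`, tied to `h`, `w` by the fundamental theorem
   of calculus in the membership predicates below. -/

open MeasureTheory Filter Topology
open scoped ENNReal NNReal

noncomputable section

/-- A function on the grid 𝒢, together with candidate derivatives along
horizontal and vertical lines. -/
structure GridFunc where
  /-- restriction to the horizontal line `H j` -/
  h : ℤ → ℝ → ℝ
  /-- restriction to the vertical line `V k` -/
  w : ℤ → ℝ → ℝ
  /-- derivative along the horizontal line `H j` -/
  hd : ℤ → ℝ → ℝ
  /-- derivative along the vertical line `V k` -/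
  wd : ℤ → ℝ → ℝ
  /-- vertex compatibility: the values at the vertex `(k, j)` agree -/
  compat : ∀ j k : ℤ, h j (k : ℝ) = w k (j : ℝ)

/-- `∑_j ∫_ℝ |f j|^p + ∑_k ∫_ℝ |g k|^p`, as an extended nonnegative real:
the `p`-th power of the `L^p(𝒢)` norm of the function encoded by `(f, g)`. -/
def gridLpPow (p : ℝ) (f g : ℤ → ℝ → ℝ) : ℝ≥0∞ :=
  (∑' j : ℤ, ∫⁻ x : ℝ, (‖f j x‖₊ : ℝ≥0∞) ^ p) +
  (∑' k : ℤ, ∫⁻ y : ℝ, (‖g k y‖₊ : ℝ≥0∞) ^ p)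

/-- The `L^p(𝒢)` norm of `u`. -/
def GridFunc.lpNorm (u : GridFunc) (p : ℝ) : ℝ≥0∞ :=
  gridLpPow p u.h u.w ^ (1 / p)

/-- The `L^p(𝒢)` norm of the derivative `u'`. -/
def GridFunc.derivLpNorm (u : GridFunc) (p : ℝ) : ℝ≥0∞ :=
  gridLpPow p u.hd u.wd ^ (1 / p)

/-- The `L^∞(𝒢)` norm of `u`: the sup over all lines of the sup norms. -/
def GridFunc.linfNorm (u : GridFunc) : ℝ≥0∞ :=
  (⨆ j : ℤ, ⨆ x : ℝ, (‖u.h j x‖₊ : ℝ≥0∞)) ⊔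
  (⨆ k : ℤ, ⨆ y : ℝ, (‖u.w k y‖₊ : ℝ≥0∞))

/-- `u ∈ H¹(𝒢)`: every line restriction is continuous and is recovered from
its (locally integrable) derivative by integration, and both `‖u‖₂²` and
`‖u'‖₂²` are finite. -/
def GridFunc.MemH1 (u : GridFunc) : Prop :=
  (∀ j, Continuous (u.h j)) ∧ (∀ k, Continuous (u.w k)) ∧
  (∀ j, LocallyIntegrable (u.hd j)) ∧ (∀ k, LocallyIntegrable (u.wd k)) ∧
  (∀ j x, (∫ t in (0:ℝ)..x, u.hd j t) = u.h j x - u.h j 0) ∧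
  (∀ k y, (∫ t in (0:ℝ)..y, u.wd k t) = u.w k y - u.w k 0) ∧
  gridLpPow 2 u.h u.w < ⊤ ∧ gridLpPow 2 u.hd u.wd < ⊤

/-- `u ∈ W^{1,1}(𝒢)`: every line restriction is continuous and is recovered
from its (integrable) derivative by integration, and both `‖u‖₁` and `‖u'‖₁`
are finite. -/
def GridFunc.MemW11 (u : GridFunc) : Prop :=
  (∀ j, Continuous (u.h j)) ∧ (∀ k, Continuous (u.w k)) ∧
  (∀ j, Integrable (u.hd j)) ∧ (∀ k, Integrable (u.wd k)) ∧
  (∀ j x, (∫ t in (0:ℝ)..x, u.hd j t) = u.h j x - u.h j 0) ∧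
  (∀ k y, (∫ t in (0:ℝ)..y, u.wd k t) = u.w k y - u.w k 0) ∧
  gridLpPow 1 u.h u.w < ⊤ ∧ gridLpPow 1 u.hd u.wd < ⊤

/-- The mass `‖u‖_{L²(𝒢)}²` of `u`, as a real number. -/
def GridFunc.mass (u : GridFunc) : ℝ :=
  (gridLpPow 2 u.h u.w).toReal

/-- The NLS energy `E_p(u) = ½‖u'‖₂² − (1/p)‖u‖_p^p`. -/
def GridFunc.energy (u : GridFunc) (p : ℝ) : ℝ :=
  (1 / 2) * (gridLpPow 2 u.hd u.wd).toReal
    - (1 / p) * (gridLpPow p u.h u.w).toReal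

/-- `u` is not identically zero on 𝒢. -/
def GridFunc.Nonzero (u : GridFunc) : Prop :=
  (∃ j x, u.h j x ≠ 0) ∨ (∃ k y, u.w k y ≠ 0)

/-- The Gagliardo–Nirenberg quotient
`Q_p(u) = ‖u‖_p^p / (‖u‖₂^{p−2} ‖u'‖₂²)`. -/
def GridFunc.gnQuot (u : GridFunc) (p : ℝ) : ℝ :=
  (gridLpPow p u.h u.w).toReal /
    ((gridLpPow 2 u.h u.w).toReal ^ ((p - 2) / 2) *
      (gridLpPow 2 u.hd u.wd).toReal)

/-- The set of Gagliardo–Nirenberg quotients `Q_p(u)` over nontrivial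
`u ∈ H¹(𝒢)`; its supremum is the optimal constant `K_p`. -/
def gnSet (p : ℝ) : Set ℝ :=
  {q | ∃ u : GridFunc, u.MemH1 ∧ u.Nonzero ∧ q = u.gnQuot p}

/-- The critical mass `μ_p = (p/(2K))^{2/(p−2)}` associated with the optimal
Gagliardo–Nirenberg constant `K`. -/
def critMass (p K : ℝ) : ℝ :=
  (p / (2 * K)) ^ (2 / (p - 2))

/-- The `H¹(𝒢)` inner product `⟨u,v⟩_{L²(𝒢)} + ⟨u',v'⟩_{L²(𝒢)}`. -/
def GridFunc.h1Inner (u v : GridFunc) : ℝ :=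
  ((∑' j : ℤ, ∫ x : ℝ, u.h j x * v.h j x) +
    (∑' k : ℤ, ∫ y : ℝ, u.w k y * v.w k y)) +
  ((∑' j : ℤ, ∫ x : ℝ, u.hd j x * v.hd j x) +
    (∑' k : ℤ, ∫ y : ℝ, u.wd k y * v.wd k y))

/-- The set of energies `E_p(u)` of functions `u ∈ H¹_μ(𝒢)`; its infimum is
the ground-state energy level `ℰ_p(μ)`. -/
def energySet (p μ : ℝ) : Set ℝ :=
  {e | ∃ u : GridFunc, u.MemH1 ∧ u.mass = μ ∧ u.energy p = e}

/-- `u` is a ground state of mass `μ`: it belongs to `H¹_μ(𝒢)` and minimizes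
the energy `E_p` there. -/
def IsGroundState (p μ : ℝ) (u : GridFunc) : Prop :=
  u.MemH1 ∧ u.mass = μ ∧
    ∀ v : GridFunc, v.MemH1 → v.mass = μ → u.energy p ≤ v.energy p

end

open MeasureTheory Filter Topology
open scoped ENNReal NNReal

noncomputable section

/-- The grid as a measurable space: disjoint union of all lines. -/
abbrev GX := (ℤ ⊕ ℤ) × ℝ

instance sum_msc : MeasurableSingletonClass (ℤ ⊕ ℤ) where
  measurableSet_singleton := by
    rintro (a | a)
    · rw [← Set.image_singleton]; exact (measurableSet_singleton a).inl_image
    · rw [← Set.image_singleton]; exact (measurableSet_singleton a).inr_image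

/-- One-dimensional measure on the grid. -/
def gnu : Measure GX := Measure.sum fun l : ℤ ⊕ ℤ => Measure.map (Prod.mk l) (volume : Measure ℝ)

instance gnu_sfinite : SFinite gnu := by
  unfold gnu; infer_instance

lemma lintegral_gnu (f : GX → ℝ≥0∞) : ∫⁻ z, f z ∂gnu = ∑' l, ∫⁻ x, f (l, x) := by
  unfold gnu
  rw [lintegral_sum_measure]
  refine tsum_congr fun l => ?_
  rw [(measurableEmbedding_prodMk_left l).lintegral_map]

lemma aesm_gnu {f : GX → ℝ} :
    AEStronglyMeasurable f gnu ↔ ∀ l, AEStronglyMeasurable (fun x => f (l, x)) volume := by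
  unfold gnu
  rw [aestronglyMeasurable_sum_measure_iff]
  refine forall_congr' fun l => ?_
  rw [(measurableEmbedding_prodMk_left l).aestronglyMeasurable_map_iff]
  rfl

lemma line_memLp {f : GX → ℝ} {q : ℝ≥0∞} (h : MemLp f q gnu) (l : ℤ ⊕ ℤ) :
    MemLp (fun x => f (l, x)) q volume := by
  have h1 : MemLp f q (Measure.map (Prod.mk l) (volume : Measure ℝ)) :=
    h.mono_measure (Measure.le_sum _ l)
  exact ((measurableEmbedding_prodMk_left l).memLp_map_measure_iff).1 h1

/-- glue two families into a function on the grid -/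
def glue (f g : ℤ → ℝ → ℝ) : GX → ℝ := fun z => Sum.elim f g z.1 z.2

@[simp] lemma glue_inl (f g : ℤ → ℝ → ℝ) (j : ℤ) (x : ℝ) : glue f g (.inl j, x) = f j x := rfl
@[simp] lemma glue_inr (f g : ℤ → ℝ → ℝ) (j : ℤ) (x : ℝ) : glue f g (.inr j, x) = g j x := rfl

lemma tsum_sumtype (f : ℤ ⊕ ℤ → ℝ≥0∞) : ∑' l, f l = ∑' j, f (.inl j) + ∑' k, f (.inr k) :=
  (ENNReal.summable.hasSum.sum (f := f) ENNReal.summable.hasSum).tsum_eq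

lemma gridLpPow_eq (p : ℝ) (f g : ℤ → ℝ → ℝ) :
    gridLpPow p f g = ∫⁻ z, ‖glue f g z‖ₑ ^ p ∂gnu := by
  rw [lintegral_gnu, tsum_sumtype]
  rfl

/-- `∫ |F|^q` -/
def Mq (q : ℝ) (F : GX → ℝ) : ℝ := ∫ z, |F z| ^ q ∂gnu

lemma Mq_nonneg (q : ℝ) (F : GX → ℝ) : 0 ≤ Mq q F := integral_nonneg fun z => by positivity

lemma gridLpPow_toReal {q : ℝ} (hq : 0 ≤ q) {f g : ℤ → ℝ → ℝ}
    (h : AEStronglyMeasurable (glue f g) gnu) :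
    (gridLpPow q f g).toReal = Mq q (glue f g) := by
  rw [gridLpPow_eq, Mq, integral_eq_lintegral_of_nonneg_ae (ae_of_all _ fun z => by positivity)]
  · congr 1
    refine lintegral_congr fun z => ?_
    rw [← ENNReal.ofReal_rpow_of_nonneg (abs_nonneg _) hq, ← Real.enorm_eq_ofReal_abs]
  · exact (h.aemeasurable.abs.pow_const q).aestronglyMeasurable

lemma memLp_two_iff {f : GX → ℝ} (h : AEStronglyMeasurable f gnu) :
    MemLp f 2 gnu ↔ ∫⁻ z, ‖f z‖ₑ ^ (2:ℝ) ∂gnu < ⊤ := by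
  constructor
  · intro hf
    have := lintegral_rpow_enorm_lt_top_of_eLpNorm_lt_top (p := 2) (by simp) (by simp) hf.2
    simpa using this
  · intro hf
    refine ⟨h, ?_⟩
    rw [eLpNorm_lt_top_iff_lintegral_rpow_enorm_lt_top (by simp) (by simp)]
    simpa using hf

/-- `H¹` on the grid, in glued form. -/
structure IsH1 (F G : GX → ℝ) : Prop where
  cont : ∀ l, Continuous fun x => F (l, x)
  ftc : ∀ l x y, ∫ t in x..y, G (l, t) = F (l, y) - F (l, x)
  memF : MemLp F 2 gnu
  memG : MemLp G 2 gnu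
  compat : ∀ j k : ℤ, F (.inl j, (k : ℝ)) = F (.inr k, (j : ℝ))

lemma IsH1.locInt {F G : GX → ℝ} (h : IsH1 F G) (l) : LocallyIntegrable fun x => G (l, x) :=
  (line_memLp h.memG l).locallyIntegrable (by norm_num)

lemma memH1_iff (u : GridFunc) : u.MemH1 ↔ IsH1 (glue u.h u.w) (glue u.hd u.wd) := by
  constructor
  · rintro ⟨h1, h2, h3, h4, h5, h6, h7, h8⟩
    have hc : ∀ l, Continuous fun x => glue u.h u.w (l, x) := by
      rintro (j | k)
      · exact h1 j
      · exact h2 k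
    have hl : ∀ l, LocallyIntegrable fun x => glue u.hd u.wd (l, x) := by
      rintro (j | k)
      · exact h3 j
      · exact h4 k
    have hf : ∀ l x, ∫ t in (0:ℝ)..x, glue u.hd u.wd (l, t)
        = glue u.h u.w (l, x) - glue u.h u.w (l, 0) := by
      rintro (j | k)
      · exact h5 j
      · exact h6 k
    refine ⟨hc, ?_, ?_, ?_, u.compat⟩
    · intro l x y
      have hi : ∀ a b, IntervalIntegrable (fun x => glue u.hd u.wd (l, x)) volume a b :=
        fun a b => ((hl l).integrableOn_isCompact isCompact_uIcc).intervalIntegrable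
      have h1 := intervalIntegral.integral_add_adjacent_intervals (hi 0 x) (hi x y)
      rw [hf, hf] at h1
      linarith
    · rw [memLp_two_iff (aesm_gnu.2 fun l => (hc l).aestronglyMeasurable), ← gridLpPow_eq]
      exact h7
    · rw [memLp_two_iff (aesm_gnu.2 fun l => (hl l).aestronglyMeasurable), ← gridLpPow_eq]
      exact h8
  · intro h
    refine ⟨fun j => h.cont (.inl j), fun j => h.cont (.inr j), fun j => h.locInt (.inl j),
      fun j => h.locInt (.inr j), fun j x => h.ftc (.inl j) 0 x, fun j x => h.ftc (.inr j) 0 x,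
      ?_, ?_⟩
    · rw [gridLpPow_eq, ← memLp_two_iff h.memF.1]; exact h.memF
    · rw [gridLpPow_eq, ← memLp_two_iff h.memG.1]; exact h.memG

/-- unglue -/
def toGrid (F G : GX → ℝ) (h : IsH1 F G) : GridFunc where
  h j x := F (.inl j, x)
  w j x := F (.inr j, x)
  hd j x := G (.inl j, x)
  wd j x := G (.inr j, x)
  compat := h.compat

lemma glue_unglue (F : GX → ℝ) : glue (fun j x => F (.inl j, x)) (fun j x => F (.inr j, x)) = F := by
  funext z
  obtain ⟨(j | j), x⟩ := z <;> rfl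

/-- glued energy -/
def IE (p : ℝ) (F G : GX → ℝ) : ℝ := 1 / 2 * Mq 2 G - 1 / p * Mq p F

lemma mass_eq {u : GridFunc} (h : IsH1 (glue u.h u.w) (glue u.hd u.wd)) :
    u.mass = Mq 2 (glue u.h u.w) := gridLpPow_toReal (by norm_num) h.memF.1

lemma energy_eq {p : ℝ} (hp : 0 ≤ p) {u : GridFunc} (h : IsH1 (glue u.h u.w) (glue u.hd u.wd)) :
    u.energy p = IE p (glue u.h u.w) (glue u.hd u.wd) := by
  unfold GridFunc.energy IE
  rw [gridLpPow_toReal (by norm_num) h.memG.1, gridLpPow_toReal hp h.memF.1]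

lemma quot_eq {p : ℝ} (hp : 0 ≤ p) {u : GridFunc} (h : IsH1 (glue u.h u.w) (glue u.hd u.wd)) :
    u.gnQuot p = Mq p (glue u.h u.w) / (Mq 2 (glue u.h u.w) ^ ((p - 2) / 2) *
      Mq 2 (glue u.hd u.wd)) := by
  unfold GridFunc.gnQuot
  rw [gridLpPow_toReal (by norm_num) h.memG.1, gridLpPow_toReal hp h.memF.1,
    gridLpPow_toReal (by norm_num) h.memF.1]

lemma nonzero_iff (u : GridFunc) : u.Nonzero ↔ glue u.h u.w ≠ 0 := by
  constructor
  · rintro (⟨j, x, h⟩ | ⟨j, x, h⟩) h0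
    · exact h (congrFun h0 (.inl j, x))
    · exact h (congrFun h0 (.inr j, x))
  · intro h
    by_contra hn
    apply h
    unfold GridFunc.Nonzero at hn
    push Not at hn
    funext z
    obtain ⟨(j | j), x⟩ := z
    · exact hn.1 j x
    · exact hn.2 j x

/-- glued GN set -/
def gnS (p : ℝ) : Set ℝ := {q | ∃ F G, IsH1 F G ∧ F ≠ 0 ∧
  q = Mq p F / (Mq 2 F ^ ((p - 2) / 2) * Mq 2 G)}

lemma gnSet_eq {p : ℝ} (hp : 0 ≤ p) : gnSet p = gnS p := by
  ext q
  constructor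
  · rintro ⟨u, h1, h2, rfl⟩
    rw [memH1_iff] at h1
    exact ⟨_, _, h1, (nonzero_iff u).1 h2, quot_eq hp h1⟩
  · rintro ⟨F, G, h1, h2, rfl⟩
    have e1 : glue (toGrid F G h1).h (toGrid F G h1).w = F := glue_unglue F
    have e2 : glue (toGrid F G h1).hd (toGrid F G h1).wd = G := glue_unglue G
    refine ⟨toGrid F G h1, ?_, ?_, ?_⟩
    · rw [memH1_iff, e1, e2]; exact h1
    · rw [nonzero_iff, e1]; exact h2
    · rw [quot_eq hp, e1, e2]
      rw [e1, e2]; exact h1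

/-- glued ground state -/
def IsGS (p μ : ℝ) (F G : GX → ℝ) : Prop := IsH1 F G ∧ Mq 2 F = μ ∧
  ∀ F' G', IsH1 F' G' → Mq 2 F' = μ → IE p F G ≤ IE p F' G'

lemma gs_of {p μ : ℝ} (hp : 0 ≤ p) {u : GridFunc} (h : IsGroundState p μ u) :
    IsGS p μ (glue u.h u.w) (glue u.hd u.wd) := by
  obtain ⟨h1, h2, h3⟩ := h
  rw [memH1_iff] at h1
  refine ⟨h1, ?_, ?_⟩
  · rw [← mass_eq h1]; exact h2
  · intro F G hFG hm
    have e1 : glue (toGrid F G hFG).h (toGrid F G hFG).w = F := glue_unglue F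
    have e2 : glue (toGrid F G hFG).hd (toGrid F G hFG).wd = G := glue_unglue G
    have hh : IsH1 (glue (toGrid F G hFG).h (toGrid F G hFG).w)
      (glue (toGrid F G hFG).hd (toGrid F G hFG).wd) := by rw [e1, e2]; exact hFG
    have := h3 (toGrid F G hFG) ((memH1_iff _).2 hh) (by rw [mass_eq hh, e1, hm])
    rwa [energy_eq hp h1, energy_eq hp hh, e1, e2] at this

lemma of_gs {p μ : ℝ} (hp : 0 ≤ p) {F G : GX → ℝ} (h : IsGS p μ F G) :
    ∃ u, IsGroundState p μ u ∧ u.energy p = IE p F G := by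
  obtain ⟨h1, h2, h3⟩ := h
  have e1 : glue (toGrid F G h1).h (toGrid F G h1).w = F := glue_unglue F
  have e2 : glue (toGrid F G h1).hd (toGrid F G h1).wd = G := glue_unglue G
  have hh : IsH1 (glue (toGrid F G h1).h (toGrid F G h1).w)
      (glue (toGrid F G h1).hd (toGrid F G h1).wd) := by rw [e1, e2]; exact h1
  refine ⟨toGrid F G h1, ⟨(memH1_iff _).2 hh, by rw [mass_eq hh, e1, h2], ?_⟩, ?_⟩
  · intro v hv hm
    rw [memH1_iff] at hv
    rw [energy_eq hp hh, energy_eq hp hv, e1, e2]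
    exact h3 _ _ hv (by rw [← mass_eq hv, hm])
  · rw [energy_eq hp hh, e1, e2]

end

open MeasureTheory Filter Topology
open scoped ENNReal NNReal

noncomputable section

lemma IsH1.intInt {F G : GX → ℝ} (h : IsH1 F G) (l) (a b : ℝ) :
    IntervalIntegrable (fun x => G (l, x)) volume a b :=
  ((h.locInt l).integrableOn_isCompact isCompact_uIcc).intervalIntegrable

lemma IsH1.sq_ftc {F G : GX → ℝ} (h : IsH1 F G) (l) (x y : ℝ) :
    ∫ t in x..y, 2 * (F (l, t) * G (l, t)) = F (l, y) ^ 2 - F (l, x) ^ 2 := by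
  have hF : (fun t => F (l, t)) = fun t => (∫ s in x..t, G (l, s)) + F (l, x) := by
    funext t; rw [h.ftc]; ring
  have hac : AbsolutelyContinuousOnInterval (fun t => F (l, t)) x y := by
    rw [hF]
    refine ((h.intInt l x y).absolutelyContinuousOnInterval_intervalIntegral (by simp)).add ?_
    exact (LipschitzWith.const (F (l, x))).lipschitzOnWith.absolutelyContinuousOnInterval
  have h1 := hac.integral_deriv_mul_eq_sub hac
  have h2 : ∫ t in x..y, 2 * (F (l, t) * G (l, t)) =
      ∫ t in x..y, deriv (fun t => F (l, t)) t * F (l, t) + F (l, t) * deriv (fun t => F (l, t)) t := by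
    apply intervalIntegral.integral_congr_ae
    filter_upwards [(h.intInt l x y).ae_hasDerivAt_integral] with t ht hm
    have h3 := ht (Set.uIoc_subset_uIcc hm) x (by simp)
    have h4 : HasDerivAt (fun t => F (l, t)) (G (l, t)) t := by
      rw [hF]; exact h3.add_const _
    rw [h4.deriv]; ring
  rw [h2, h1]; ring

/-- local version -/
lemma IsH1.sq_le {F G : GX → ℝ} (h : IsH1 F G) (l) (x y : ℝ) :
    ‖F (l, y)‖ₑ ^ 2 ≤ ‖F (l, x)‖ₑ ^ 2 +
      ∫⁻ t in Set.uIoc x y, ‖2 * (F (l, t) * G (l, t))‖ₑ := by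
  have h1 := h.sq_ftc l x y
  have h2 : F (l, y) ^ 2 = F (l, x) ^ 2 + ∫ t in x..y, 2 * (F (l, t) * G (l, t)) := by
    rw [h1]; ring
  calc ‖F (l, y)‖ₑ ^ 2 = ‖F (l, y) ^ 2‖ₑ := by rw [enorm_pow]
    _ ≤ ‖F (l, x) ^ 2‖ₑ + ‖∫ t in x..y, 2 * (F (l, t) * G (l, t))‖ₑ := by
        rw [h2]; exact enorm_add_le _ _
    _ ≤ _ := by
        rw [enorm_pow]
        gcongr
        rw [← ofReal_norm, intervalIntegral.norm_integral_eq_norm_integral_uIoc,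
          ofReal_norm]
        exact enorm_integral_le_lintegral_enorm _

/-- W^{1,1} seminorm of F^2 on a line -/
def lineA (F G : GX → ℝ) (l : ℤ ⊕ ℤ) : ℝ≥0∞ := ∫⁻ t, ‖2 * (F (l, t) * G (l, t))‖ₑ

lemma IsH1.sq_le_line {F G : GX → ℝ} (h : IsH1 F G) (l) (x : ℝ) :
    ‖F (l, x)‖ₑ ^ 2 ≤ lineA F G l := by
  by_contra hc
  push Not at hc
  have h1 : ∀ y, ‖F (l, x)‖ₑ ^ 2 - lineA F G l ≤ ‖F (l, y)‖ₑ ^ 2 := by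
    intro y
    rw [tsub_le_iff_right]
    refine (h.sq_le l y x).trans ?_
    gcongr
    exact setLIntegral_le_lintegral _ _
  have h2 : ∫⁻ y, ‖F (l, y)‖ₑ ^ (2:ℝ) < ⊤ := by
    have := lintegral_rpow_enorm_lt_top_of_eLpNorm_lt_top (p := 2) (by simp) (by simp)
      (line_memLp h.memF l).2
    simpa using this
  have h3 : ∫⁻ _ : ℝ, (‖F (l, x)‖ₑ ^ 2 - lineA F G l) ≤ ∫⁻ y, ‖F (l, y)‖ₑ ^ (2:ℝ) := by
    refine lintegral_mono fun y => ?_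
    have := h1 y
    simpa using this
  rw [lintegral_const, Real.volume_univ, ENNReal.mul_top (tsub_pos_of_lt hc).ne'] at h3
  exact absurd (h3.trans_lt h2) (lt_irrefl _)

/-- total -/
def totA (F G : GX → ℝ) : ℝ≥0∞ := ∫⁻ z, ‖2 * (F z * G z)‖ₑ ∂gnu

lemma totA_eq (F G : GX → ℝ) : totA F G = ∑' l, lineA F G l := lintegral_gnu _

lemma mem_Mq {F : GX → ℝ} (h : MemLp F 2 gnu) :
    ∫⁻ z, ‖F z‖ₑ ^ (2:ℝ) ∂gnu = ENNReal.ofReal (Mq 2 F) := by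
  have h1 := (memLp_two_iff h.1).1 h
  rw [Mq, integral_eq_lintegral_of_nonneg_ae (ae_of_all _ fun z => by positivity)]
  · rw [ENNReal.ofReal_toReal]
    · refine lintegral_congr fun z => ?_
      rw [← ENNReal.ofReal_rpow_of_nonneg (abs_nonneg _) (by norm_num), ← Real.enorm_eq_ofReal_abs]
    · convert! h1.ne using 1
      refine lintegral_congr fun z => ?_
      rw [← ENNReal.ofReal_rpow_of_nonneg (abs_nonneg _) (by norm_num), ← Real.enorm_eq_ofReal_abs]
  · exact (h.1.aemeasurable.abs.pow_const _).aestronglyMeasurable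

lemma totA_le {F G : GX → ℝ} (hF : MemLp F 2 gnu) (hG : MemLp G 2 gnu) :
    totA F G ≤ ENNReal.ofReal (2 * √(Mq 2 F * Mq 2 G)) := by
  have h1 := ENNReal.lintegral_mul_le_Lp_mul_Lq gnu Real.HolderConjugate.two_two
    hF.1.enorm hG.1.enorm
  rw [mem_Mq hF, mem_Mq hG] at h1
  have h2 : totA F G = 2 * ∫⁻ z, ((fun z => ‖F z‖ₑ) * (fun z => ‖G z‖ₑ)) z ∂gnu := by
    rw [← lintegral_const_mul']
    · refine lintegral_congr fun z => ?_
      rw [enorm_mul, enorm_mul]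
      congr 1
      rw [Real.enorm_eq_ofReal_abs]; simp
    · simp
  rw [h2, ENNReal.ofReal_mul (by norm_num)]
  have h3 : ENNReal.ofReal (√(Mq 2 F * Mq 2 G)) =
      ENNReal.ofReal (Mq 2 F) ^ (1/2:ℝ) * ENNReal.ofReal (Mq 2 G) ^ (1/2:ℝ) := by
    rw [ENNReal.ofReal_rpow_of_nonneg (Mq_nonneg _ _) (by norm_num),
      ENNReal.ofReal_rpow_of_nonneg (Mq_nonneg _ _) (by norm_num), ← Real.sqrt_eq_rpow,
      ← Real.sqrt_eq_rpow, ← ENNReal.ofReal_mul (Real.sqrt_nonneg _), Real.sqrt_mul (Mq_nonneg _ _)]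
  rw [h3]
  simpa using mul_le_mul_right h1 2

lemma IsH1.sup_le {F G : GX → ℝ} (h : IsH1 F G) (z : GX) :
    F z ^ 2 ≤ 2 * √(Mq 2 F * Mq 2 G) := by
  obtain ⟨l, x⟩ := z
  have h1 : ‖F (l, x)‖ₑ ^ 2 ≤ ENNReal.ofReal (2 * √(Mq 2 F * Mq 2 G)) := by
    refine (h.sq_le_line l x).trans (le_trans ?_ (totA_le h.memF h.memG))
    rw [totA_eq]
    exact ENNReal.le_tsum l
  rw [← enorm_pow, Real.enorm_eq_ofReal (sq_nonneg _)] at h1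
  exact (ENNReal.ofReal_le_ofReal_iff (by positivity)).1 h1

lemma double_sum (f : ℤ → ℝ → ℝ≥0∞) (a b : ℤ → ℝ≥0∞) (c : ℤ → ℤ → ℝ≥0∞)
    (hc : ∀ j, ∑' k, c j k = a j) (h1 : ∀ j x, f j x ≤ a j)
    (h2 : ∀ (j k : ℤ) (x : ℝ), x ∈ Set.Ico (k:ℝ) (k+1) → f j x ≤ b k + c j k) :
    ∑' j, ∫⁻ x, f j x ^ 2 ≤ (∑' j, a j) * (∑' k, b k) + (∑' j, a j) ^ 2 := by
  have h3 : ∀ j, ∫⁻ x, f j x ^ 2 ≤ a j * (∑' k, b k) + a j * a j := by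
    intro j
    have e : ∫⁻ x, f j x ^ 2 = ∑' k : ℤ, ∫⁻ x in Set.Ico (k:ℝ) (k+1), f j x ^ 2 := by
      rw [← lintegral_iUnion (fun k => measurableSet_Ico) (Set.pairwise_disjoint_Ico_intCast ℝ),
        iUnion_Ico_intCast, Measure.restrict_univ]
    rw [e]
    have e2 : a j * (∑' k, b k) + a j * a j = ∑' k, a j * (b k + c j k) := by
      rw [ENNReal.tsum_mul_left, ENNReal.tsum_add, hc, mul_add]
    rw [e2]
    refine ENNReal.tsum_le_tsum fun k => ?_
    calc ∫⁻ x in Set.Ico (k:ℝ) (k+1), f j x ^ 2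
        ≤ ∫⁻ x in Set.Ico (k:ℝ) (k+1), a j * (b k + c j k) := by
          refine setLIntegral_mono' measurableSet_Ico fun x hx => ?_
          rw [sq]
          exact mul_le_mul' (h1 j x) (h2 j k x hx)
      _ = _ := by
          rw [setLIntegral_const, Real.volume_Ico]; simp
  refine (ENNReal.tsum_le_tsum h3).trans ?_
  rw [ENNReal.tsum_add, ENNReal.tsum_mul_right]
  gcongr
  rw [sq, ← ENNReal.tsum_mul_right]
  exact ENNReal.tsum_le_tsum fun j => mul_le_mul' le_rfl (ENNReal.le_tsum j)

lemma IsH1.l4_aux {F G : GX → ℝ} (h : IsH1 F G) : ∫⁻ z, (‖F z‖ₑ ^ 2) ^ 2 ∂gnu ≤ totA F G ^ 2 := by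
  have hc : ∀ l, ∑' k : ℤ, ∫⁻ t in Set.Ico (k:ℝ) (k+1), ‖2 * (F (l, t) * G (l, t))‖ₑ
      = lineA F G l := by
    intro l
    rw [← lintegral_iUnion (fun k => measurableSet_Ico) (Set.pairwise_disjoint_Ico_intCast ℝ),
        iUnion_Ico_intCast, Measure.restrict_univ]
    rfl
  have key : ∀ (l) (k : ℤ) (x : ℝ), x ∈ Set.Ico (k:ℝ) (k+1) → ‖F (l, x)‖ₑ ^ 2 ≤
      ‖F (l, (k:ℝ))‖ₑ ^ 2 + ∫⁻ t in Set.Ico (k:ℝ) (k+1), ‖2 * (F (l, t) * G (l, t))‖ₑ := by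
    intro l k x hx
    refine (h.sq_le l k x).trans ?_
    gcongr 1
    apply lintegral_mono_set
    rw [Set.uIoc_of_le hx.1]
    intro t ht
    exact ⟨ht.1.le, ht.2.trans_lt hx.2⟩
  have hH := double_sum (fun j x => ‖F (.inl j, x)‖ₑ ^ 2) (fun j => lineA F G (.inl j))
    (fun k => lineA F G (.inr k)) _ (fun j => hc (.inl j)) (fun j x => h.sq_le_line _ x)
    (fun j k x hx => (key _ k x hx).trans (by
      gcongr
      rw [h.compat]
      exact h.sq_le_line _ _))
  have hV := double_sum (fun j x => ‖F (.inr j, x)‖ₑ ^ 2) (fun j => lineA F G (.inr j))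
    (fun k => lineA F G (.inl k)) _ (fun j => hc (.inr j)) (fun j x => h.sq_le_line _ x)
    (fun j k x hx => (key _ k x hx).trans (by
      gcongr
      rw [← h.compat]
      exact h.sq_le_line _ _))
  rw [lintegral_gnu, tsum_sumtype, totA_eq, tsum_sumtype]
  refine (add_le_add hH hV).trans (le_of_eq ?_)
  ring

lemma IsH1.l4 {F G : GX → ℝ} (h : IsH1 F G) :
    Integrable (fun z => F z ^ 4) gnu ∧ ∫ z, F z ^ 4 ∂gnu ≤ 4 * (Mq 2 F * Mq 2 G) := by
  have h1 := h.l4_aux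
  have h2 : totA F G ^ 2 ≤ ENNReal.ofReal (4 * (Mq 2 F * Mq 2 G)) := by
    refine (pow_le_pow_left' (totA_le h.memF h.memG) 2).trans (le_of_eq ?_)
    rw [← ENNReal.ofReal_pow (by positivity), mul_pow, Real.sq_sqrt
      (mul_nonneg (Mq_nonneg _ _) (Mq_nonneg _ _))]
    norm_num
  have h3 : ∫⁻ z, ‖F z ^ 4‖ₑ ∂gnu ≤ ENNReal.ofReal (4 * (Mq 2 F * Mq 2 G)) := by
    refine le_trans (le_of_eq ?_) (h1.trans h2)
    refine lintegral_congr fun z => ?_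
    rw [enorm_pow, ← pow_mul]
  have hm : AEStronglyMeasurable (fun z => F z ^ 4) gnu := h.memF.1.pow 4
  refine ⟨⟨hm, h3.trans_lt ENNReal.ofReal_lt_top⟩, ?_⟩
  rw [integral_eq_lintegral_of_nonneg_ae (ae_of_all _ fun z => by positivity) hm]
  refine ENNReal.toReal_le_of_le_ofReal
    (mul_nonneg (by norm_num) (mul_nonneg (Mq_nonneg _ _) (Mq_nonneg _ _))) (le_trans (le_of_eq ?_) h3)
  refine lintegral_congr fun z => ?_
  rw [Real.enorm_eq_ofReal (by positivity)]

end

open MeasureTheory Filter Topology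
open scoped ENNReal NNReal

noncomputable section

lemma Mq_eq_toReal {q : ℝ} (hq : 0 ≤ q) {F : GX → ℝ} (h : AEStronglyMeasurable F gnu) :
    Mq q F = (∫⁻ z, ‖F z‖ₑ ^ q ∂gnu).toReal := by
  rw [Mq, integral_eq_lintegral_of_nonneg_ae (ae_of_all _ fun z => by positivity)]
  · congr 1
    refine lintegral_congr fun z => ?_
    rw [← ENNReal.ofReal_rpow_of_nonneg (abs_nonneg _) hq, ← Real.enorm_eq_ofReal_abs]
  · exact (h.aemeasurable.abs.pow_const q).aestronglyMeasurable

lemma aesm_abs_rpow {F : GX → ℝ} (h : AEStronglyMeasurable F gnu) (q : ℝ) :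
    AEStronglyMeasurable (fun z => |F z| ^ q) gnu :=
  (h.aemeasurable.abs.pow_const q).aestronglyMeasurable

lemma Mq_two (F : GX → ℝ) : Mq 2 F = ∫ z, F z ^ 2 ∂gnu := by
  unfold Mq
  refine integral_congr_ae (ae_of_all _ fun z => ?_)
  simp

lemma integrable_two {F : GX → ℝ} (h : MemLp F 2 gnu) : Integrable (fun z => |F z| ^ (2:ℝ)) gnu := by
  have := h.integrable_sq
  refine this.congr (ae_of_all _ fun z => ?_)
  simp

lemma rpow_le_of_bd {S a q r : ℝ} (hr : 0 ≤ r) (hq : r ≤ q) (ha : 0 ≤ a) (hS : a ≤ S) :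
    a ^ q ≤ S ^ (q - r) * a ^ r := by
  rcases ha.eq_or_lt with rfl | h0
  · rcases hr.eq_or_lt with rfl | hr
    · simpa using Real.rpow_le_rpow le_rfl hS hq
    · rw [Real.zero_rpow (by linarith), Real.zero_rpow hr.ne']; simp
  · have : a ^ q = a ^ (q - r) * a ^ r := by rw [← Real.rpow_add h0]; ring_nf
    rw [this]
    gcongr

lemma integrable_of_bd {F : GX → ℝ} (h : MemLp F 2 gnu) {S : ℝ} (hS : ∀ z, |F z| ≤ S) {q : ℝ}
    (hq : 2 ≤ q) : Integrable (fun z => |F z| ^ q) gnu := by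
  refine ((integrable_two h).const_mul (S ^ (q - 2))).mono' (aesm_abs_rpow h.1 q)
    (ae_of_all _ fun z => ?_)
  rw [Real.norm_of_nonneg (by positivity)]
  exact rpow_le_of_bd (by norm_num) hq (abs_nonneg _) (hS z)

lemma Mq_le_of_bd {F : GX → ℝ} (h : MemLp F 2 gnu) {S : ℝ} (hS : ∀ z, |F z| ≤ S) {q : ℝ}
    (hq : 2 ≤ q) : Mq q F ≤ S ^ (q - 2) * Mq 2 F := by
  unfold Mq
  rw [← integral_const_mul]
  refine integral_mono (integrable_of_bd h hS hq) ((integrable_two h).const_mul _) fun z => ?_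
  exact rpow_le_of_bd (by norm_num) hq (abs_nonneg _) (hS z)

/-- the sup bound -/
def supB (F G : GX → ℝ) : ℝ := √(2 * √(Mq 2 F * Mq 2 G))

lemma IsH1.abs_le {F G : GX → ℝ} (h : IsH1 F G) (z : GX) : |F z| ≤ supB F G :=
  Real.abs_le_sqrt (h.sup_le z)

lemma IsH1.integrable_q {F G : GX → ℝ} (h : IsH1 F G) {q : ℝ} (hq : 2 ≤ q) :
    Integrable (fun z => |F z| ^ q) gnu := integrable_of_bd h.memF h.abs_le hq

lemma IsH1.Mq_le {F G : GX → ℝ} (h : IsH1 F G) {q : ℝ} (hq : 2 ≤ q) :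
    Mq q F ≤ supB F G ^ (q - 2) * Mq 2 F := Mq_le_of_bd h.memF h.abs_le hq

lemma IsH1.Mq_le4 {F G : GX → ℝ} (h : IsH1 F G) {q : ℝ} (hq : 4 ≤ q) :
    Mq q F ≤ supB F G ^ (q - 4) * (4 * (Mq 2 F * Mq 2 G)) := by
  refine le_trans ?_ (mul_le_mul_of_nonneg_left h.l4.2 (Real.rpow_nonneg (Real.sqrt_nonneg _) _))
  unfold Mq
  rw [← integral_const_mul]
  refine integral_mono (h.integrable_q (by linarith)) (h.l4.1.const_mul _) fun z => ?_
  have h1 := rpow_le_of_bd (r := 4) (by norm_num) hq (abs_nonneg _) (h.abs_le z)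
  have h2 : |F z| ^ (4:ℝ) = F z ^ 4 := by
    have : |F z| ^ (4:ℝ) = |F z| ^ 4 := by exact_mod_cast Real.rpow_natCast _ 4
    rw [this, (by decide : Even 4).pow_abs]
  rw [h2] at h1
  exact h1

lemma IsH1.pos {F G : GX → ℝ} (h : IsH1 F G) (h0 : F ≠ 0) : 0 < Mq 2 F ∧ 0 < Mq 2 G := by
  have h1 : ∃ z, F z ≠ 0 := by
    by_contra hn
    push Not at hn
    exact h0 (funext hn)
  obtain ⟨z, hz⟩ := h1
  have h2 := h.sup_le z
  have h3 : 0 < F z ^ 2 := by positivity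
  have h4 : 0 < √(Mq 2 F * Mq 2 G) := by linarith
  rw [Real.sqrt_pos] at h4
  constructor
  · exact pos_of_mul_pos_left h4 (Mq_nonneg _ _)
  · exact pos_of_mul_pos_right h4 (Mq_nonneg _ _)

lemma IsH1.ne_zero {F G : GX → ℝ} (_h : IsH1 F G) (h0 : 0 < Mq 2 F) : F ≠ 0 := by
  rintro rfl
  simp [Mq] at h0

lemma IsH1.pos_q {F G : GX → ℝ} (h : IsH1 F G) (h0 : 0 < Mq 2 F) {q : ℝ} (hq : 2 ≤ q) :
    0 < Mq q F := by
  refine lt_of_le_of_ne (Mq_nonneg _ _) fun he => ?_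
  have h1 := (integral_eq_zero_iff_of_nonneg (fun z => by positivity) (h.integrable_q hq)).1 he.symm
  apply h0.ne'
  rw [Mq_two]
  refine integral_eq_zero_of_ae ?_
  filter_upwards [h1] with z hz
  have hz : |F z| ^ q = 0 := hz
  rw [Real.rpow_eq_zero_iff_of_nonneg (abs_nonneg _)] at hz
  simpa using hz.1

lemma Mq_smul (q c : ℝ) (F : GX → ℝ) : Mq q (fun z => c * F z) = |c| ^ q * Mq q F := by
  unfold Mq
  rw [← integral_const_mul]
  refine integral_congr_ae (ae_of_all _ fun z => ?_)
  simp only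
  rw [abs_mul, Real.mul_rpow (abs_nonneg _) (abs_nonneg _)]

lemma IsH1.smul {F G : GX → ℝ} (h : IsH1 F G) (c : ℝ) :
    IsH1 (fun z => c * F z) (fun z => c * G z) where
  cont l := continuous_const.mul (h.cont l)
  ftc l x y := by rw [intervalIntegral.integral_const_mul, h.ftc]; ring
  memF := h.memF.const_mul c
  memG := h.memG.const_mul c
  compat j k := by rw [h.compat]

lemma IsH1.sub {F G F' G' : GX → ℝ} (h : IsH1 F G) (h' : IsH1 F' G') :
    IsH1 (fun z => F z - F' z) (fun z => G z - G' z) where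
  cont l := (h.cont l).sub (h'.cont l)
  ftc l x y := by
    rw [intervalIntegral.integral_sub (h.intInt l x y) (h'.intInt l x y), h.ftc, h'.ftc]; ring
  memF := h.memF.sub h'.memF
  memG := h.memG.sub h'.memG
  compat j k := by rw [h.compat, h'.compat]

/-- symmetries -/
def tau (s : Equiv.Perm (ℤ ⊕ ℤ)) (t : ℤ ⊕ ℤ → ℝ) (z : GX) : GX := (s z.1, z.2 + t z.1)

lemma lintegral_tau (s : Equiv.Perm (ℤ ⊕ ℤ)) (t : ℤ ⊕ ℤ → ℝ) (f : GX → ℝ≥0∞) :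
    ∫⁻ z, f (tau s t z) ∂gnu = ∫⁻ z, f z ∂gnu := by
  rw [lintegral_gnu, lintegral_gnu]
  unfold tau
  simp only
  rw [← Equiv.tsum_eq s (fun l => ∫⁻ x, f (l, x))]
  refine tsum_congr fun l => ?_
  exact lintegral_add_right_eq_self (fun x => f (s l, x)) (t l)

lemma aesm_tau (s : Equiv.Perm (ℤ ⊕ ℤ)) (t : ℤ ⊕ ℤ → ℝ) {f : GX → ℝ}
    (hf : AEStronglyMeasurable f gnu) : AEStronglyMeasurable (fun z => f (tau s t z)) gnu := by
  rw [aesm_gnu] at hf ⊢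
  intro l
  exact (hf (s l)).comp_measurePreserving (measurePreserving_add_right volume (t l))

lemma Mq_tau (s : Equiv.Perm (ℤ ⊕ ℤ)) (t : ℤ ⊕ ℤ → ℝ) {f : GX → ℝ}
    (hf : AEStronglyMeasurable f gnu) {q : ℝ} (hq : 0 ≤ q) :
    Mq q (fun z => f (tau s t z)) = Mq q f := by
  rw [Mq_eq_toReal hq (aesm_tau s t hf), Mq_eq_toReal hq hf,
    lintegral_tau s t (fun z => ‖f z‖ₑ ^ q)]

lemma memLp_tau (s : Equiv.Perm (ℤ ⊕ ℤ)) (t : ℤ ⊕ ℤ → ℝ) {f : GX → ℝ}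
    (hf : MemLp f 2 gnu) : MemLp (fun z => f (tau s t z)) 2 gnu := by
  rw [memLp_two_iff (aesm_tau s t hf.1), lintegral_tau s t (fun z => ‖f z‖ₑ ^ (2:ℝ)),
    ← memLp_two_iff hf.1]
  exact hf

lemma IsH1.tau {F G : GX → ℝ} (h : IsH1 F G) (s : Equiv.Perm (ℤ ⊕ ℤ)) (t : ℤ ⊕ ℤ → ℝ)
    (hc : ∀ j k : ℤ, F (tau s t (.inl j, (k : ℝ))) = F (tau s t (.inr k, (j : ℝ)))) :
    IsH1 (fun z => F (tau s t z)) (fun z => G (tau s t z)) where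
  cont l := (h.cont (s l)).comp (continuous_add_const (t l))
  ftc l x y := by
    have := intervalIntegral.integral_comp_add_right (a := x) (b := y) (fun x => G (s l, x)) (t l)
    rw [h.ftc] at this
    exact this
  memF := memLp_tau s t h.memF
  memG := memLp_tau s t h.memG
  compat := hc

/-- move a point to the base edge -/
lemma IsH1.move {F G : GX → ℝ} (h : IsH1 F G) (z : GX) : ∃ F' G', IsH1 F' G' ∧
    (∀ q, 0 ≤ q → Mq q F' = Mq q F) ∧ (∀ q, 0 ≤ q → Mq q G' = Mq q G) ∧
    ∃ x ∈ Set.Icc (0:ℝ) 1, F' (.inl 0, x) = F z := by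
  have hor : ∀ {F G : GX → ℝ} (_ : IsH1 F G) (j : ℤ) (x : ℝ), ∃ F' G', IsH1 F' G' ∧
    (∀ q, 0 ≤ q → Mq q F' = Mq q F) ∧ (∀ q, 0 ≤ q → Mq q G' = Mq q G) ∧
    ∃ y ∈ Set.Icc (0:ℝ) 1, F' (.inl 0, y) = F (.inl j, x) := by
    intro F G h j x
    refine ⟨_, _, h.tau (Equiv.sumCongr (Equiv.addRight j) (Equiv.addRight ⌊x⌋))
      (Sum.elim (fun _ => (⌊x⌋ : ℝ)) (fun _ => (j : ℝ))) ?_, fun q hq => Mq_tau _ _ h.memF.1 hq,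
      fun q hq => Mq_tau _ _ h.memG.1 hq, Int.fract x, ⟨Int.fract_nonneg _, (Int.fract_lt_one _).le⟩,
      ?_⟩
    · intro i k
      simp only [_root_.tau, Equiv.sumCongr_apply, Sum.map_inl, Sum.map_inr, Sum.elim_inl, Sum.elim_inr,
        Equiv.coe_addRight]
      have := h.compat (i + j) (k + ⌊x⌋)
      push_cast at this
      exact this
    · simp [_root_.tau, Int.fract_add_floor]
  obtain ⟨(j | k), x⟩ := z
  · exact hor h j x
  · have hs := h.tau (Equiv.sumComm ℤ ℤ) (fun _ => 0) (by
      intro i k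
      simp only [_root_.tau, Equiv.sumComm_apply, Sum.swap_inl, Sum.swap_inr, add_zero]
      exact (h.compat k i).symm)
    obtain ⟨F', G', h1, h2, h3, y, hy, h4⟩ := hor hs k x
    refine ⟨F', G', h1, fun q hq => ?_, fun q hq => ?_, y, hy, ?_⟩
    · rw [h2 q hq, Mq_tau _ _ h.memF.1 hq]
    · rw [h3 q hq, Mq_tau _ _ h.memG.1 hq]
    · rw [h4]; simp [_root_.tau]

lemma integrable_exp_abs {c : ℝ} (hc : 0 < c) : Integrable (fun x : ℝ => Real.exp (-(c * |x|))) := by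
  rw [← integrableOn_univ, ← Set.Iic_union_Ioi (a := (0:ℝ))]
  refine IntegrableOn.union ?_ ?_
  · refine (integrableOn_exp_mul_Iic hc 0).congr_fun (fun x hx => ?_) measurableSet_Iic
    simp [abs_of_nonpos (Set.mem_Iic.1 hx)]
  · refine (integrableOn_exp_mul_Ioi (a := -c) (by linarith) 0).congr_fun (fun x hx => ?_)
      measurableSet_Ioi
    simp [abs_of_pos (Set.mem_Ioi.1 hx)]

lemma summable_exp_abs {c : ℝ} (hc : 0 < c) : Summable (fun n : ℤ => Real.exp (-(c * |(n:ℝ)|))) := by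
  have : Summable (fun n : ℕ => Real.exp (-(c * (n:ℝ)))) := by
    have h1 := Real.summable_exp_nat_mul_iff (a := -c)
    have h2 := h1.2 (by linarith)
    refine h2.congr fun n => ?_
    congr 1; ring
  rw [summable_int_iff_summable_nat_and_neg]
  simpa using this

/-- test function -/
def tF (e : ℝ) (z : GX) : ℝ := Real.exp (-(e * |((Sum.elim id id z.1 : ℤ) : ℝ)|)) * Real.exp (-(e * |z.2|))
/-- its derivative -/
def tG (e : ℝ) (z : GX) : ℝ := (if 0 ≤ z.2 then -e else e) * tF e z

lemma aesm_of_meas {f : GX → ℝ} (h : ∀ l, Measurable fun x => f (l, x)) :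
    AEStronglyMeasurable f gnu := aesm_gnu.2 fun l => (h l).aestronglyMeasurable

lemma tF_cont (e : ℝ) (l) : Continuous fun x => tF e (l, x) := by
  unfold tF; fun_prop

lemma tG_meas (e : ℝ) (l) : Measurable fun x => tG e (l, x) := by
  unfold tG
  refine Measurable.mul ?_ (tF_cont e l).measurable
  exact Measurable.ite measurableSet_Ici measurable_const measurable_const

lemma tG_abs {e : ℝ} (he : 0 < e) (z) : |tG e z| = e * |tF e z| := by
  unfold tG
  rw [abs_mul]
  split_ifs
  · rw [abs_neg, abs_of_pos he]
  · rw [abs_of_pos he]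

lemma tF_memLp {e : ℝ} (he : 0 < e) : MemLp (tF e) 2 gnu := by
  rw [memLp_two_iff (aesm_of_meas fun l => (tF_cont e l).measurable), lintegral_gnu]
  have h1 : ∀ l x, ‖tF e (l, x)‖ₑ ^ (2:ℝ) =
    ENNReal.ofReal (Real.exp (-((2 * e) * |((Sum.elim id id l : ℤ) : ℝ)|))) *
      ENNReal.ofReal (Real.exp (-((2 * e) * |x|))) := by
    intro l x
    rw [Real.enorm_eq_ofReal (by unfold tF; positivity),
      ENNReal.ofReal_rpow_of_nonneg (by unfold tF; positivity) (by norm_num),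
      ← ENNReal.ofReal_mul (by positivity)]
    congr 1
    unfold tF
    rw [Real.mul_rpow (by positivity) (by positivity), ← Real.exp_mul, ← Real.exp_mul]
    congr 2 <;> ring
  simp_rw [h1]
  have h2 : ∀ l : ℤ ⊕ ℤ, ∫⁻ x : ℝ, ENNReal.ofReal (Real.exp (-((2 * e) * |((Sum.elim id id l : ℤ) : ℝ)|))) *
      ENNReal.ofReal (Real.exp (-((2 * e) * |x|))) =
      ENNReal.ofReal (Real.exp (-((2 * e) * |((Sum.elim id id l : ℤ) : ℝ)|))) *
      ∫⁻ x : ℝ, ENNReal.ofReal (Real.exp (-((2 * e) * |x|))) := fun l =>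
    lintegral_const_mul' _ _ ENNReal.ofReal_ne_top
  simp_rw [h2]
  rw [ENNReal.tsum_mul_right, tsum_sumtype]
  have h3 : ∑' n : ℤ, ENNReal.ofReal (Real.exp (-((2 * e) * |(n : ℝ)|))) ≠ ⊤ :=
    (summable_exp_abs (c := 2 * e) (by positivity)).tsum_ofReal_ne_top
  have h4 : ∫⁻ x : ℝ, ENNReal.ofReal (Real.exp (-((2 * e) * |x|))) < ⊤ :=
    (integrable_exp_abs (c := 2 * e) (by positivity)).lintegral_lt_top
  refine ENNReal.mul_lt_top ?_ h4
  simp only [Sum.elim_inl, Sum.elim_inr, id]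
  exact ENNReal.add_lt_top.2 ⟨h3.lt_top, h3.lt_top⟩

lemma test_isH1 {e : ℝ} (he : 0 < e) : IsH1 (tF e) (tG e) := by
  have hG : MemLp (tG e) 2 gnu := by
    refine ((tF_memLp he).const_mul e).of_le (aesm_of_meas (tG_meas e)) (ae_of_all _ fun z => ?_)
    rw [Real.norm_eq_abs, tG_abs he, Real.norm_eq_abs, abs_mul, abs_of_pos he]
  refine ⟨tF_cont e, ?_, tF_memLp he, hG, ?_⟩
  · intro l x y
    refine integral_eq_of_hasDerivAt_off_countable (fun x => tF e (l, x)) (fun x => tG e (l, x))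
      (Set.countable_singleton 0) (tF_cont e l).continuousOn ?_ ?_
    · intro t ht
      have ht0 : t ≠ 0 := by simpa using ht.2
      rcases lt_or_gt_of_ne ht0 with h | h
      · have h1 : HasDerivAt (fun x : ℝ => |x|) (-1) t := hasDerivAt_abs_neg h
        have h2 := ((h1.const_mul e).neg.exp).const_mul
          (Real.exp (-(e * |((Sum.elim id id l : ℤ) : ℝ)|)))
        convert! h2 using 1
        simp only [tG, tF, not_le.2 h, if_false, Pi.neg_apply]; ring
      · have h1 : HasDerivAt (fun x : ℝ => |x|) 1 t := hasDerivAt_abs_pos h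
        have h2 := ((h1.const_mul e).neg.exp).const_mul
          (Real.exp (-(e * |((Sum.elim id id l : ℤ) : ℝ)|)))
        convert! h2 using 1
        simp only [tG, tF, h.le, if_true, Pi.neg_apply]; ring
    · exact (((line_memLp hG l).locallyIntegrable (by norm_num)).integrableOn_isCompact
        isCompact_uIcc).intervalIntegrable
  · intro j k
    simp only [tF, Sum.elim_inl, Sum.elim_inr, id]
    ring

lemma test_mass {e : ℝ} (he : 0 < e) : Mq 2 (tG e) = e ^ 2 * Mq 2 (tF e) := by
  unfold Mq
  rw [← integral_const_mul]
  refine integral_congr_ae (ae_of_all _ fun z => ?_)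
  simp only
  rw [tG_abs he]
  simp [mul_pow]

lemma test_pos {e : ℝ} (he : 0 < e) : 0 < Mq 2 (tF e) := by
  refine ((test_isH1 he).pos fun h => ?_).1
  have := congrFun h (.inl 0, 0)
  simp [tF] at this

/-- normalisation -/
lemma IsH1.normalize {F G : GX → ℝ} (h : IsH1 F G) (h0 : 0 < Mq 2 F) {μ : ℝ} (hμ : 0 < μ) :
    ∃ c, 0 < c ∧ c ^ 2 = μ / Mq 2 F ∧ IsH1 (fun z => c * F z) (fun z => c * G z) ∧
      Mq 2 (fun z => c * F z) = μ := by
  have hc : 0 < μ / Mq 2 F := by positivity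
  refine ⟨√(μ / Mq 2 F), Real.sqrt_pos.2 hc, Real.sq_sqrt hc.le, h.smul _, ?_⟩
  rw [Mq_smul, abs_of_nonneg (Real.sqrt_nonneg _), Real.rpow_two, Real.sq_sqrt hc.le]
  field_simp

lemma exists_test {μ : ℝ} (hμ : 0 < μ) {e : ℝ} (he : 0 < e) :
    ∃ F G, IsH1 F G ∧ Mq 2 F = μ ∧ Mq 2 G = e ^ 2 * μ := by
  obtain ⟨c, hc, hc2, h1, h2⟩ := (test_isH1 he).normalize (test_pos he) hμ
  refine ⟨_, _, h1, h2, ?_⟩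
  rw [← h2, Mq_smul, Mq_smul, test_mass he]; ring

end

open MeasureTheory Filter Topology
open scoped ENNReal NNReal

noncomputable section

lemma bl_key {q : ℝ} (hq : 0 < q) {e : ℝ} (he : 0 < e) :
    ∃ C, 0 < C ∧ ∀ a b : ℝ, 0 ≤ a → 0 ≤ b → (a + b) ^ q ≤ (1 + e) * a ^ q + C * b ^ q := by
  have h1 : Tendsto (fun d : ℝ => (1 + d) ^ q) (𝓝[>] 0) (𝓝 1) := by
    have : ContinuousAt (fun d : ℝ => (1 + d) ^ q) 0 := by
      refine ContinuousAt.rpow_const (by fun_prop) (Or.inl (by norm_num))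
    have h2 := this.tendsto
    simp only [add_zero, Real.one_rpow] at h2
    exact h2.mono_left nhdsWithin_le_nhds
  have h2 := (h1.eventually (gt_mem_nhds (by linarith : (1:ℝ) < 1 + e))).and self_mem_nhdsWithin
  obtain ⟨d, hd1, hd0⟩ := h2.exists
  have hd0 : 0 < d := hd0
  refine ⟨(1 / d + 1) ^ q, by positivity, fun a b ha hb => ?_⟩
  rcases le_total b (d * a) with h | h
  · calc (a + b) ^ q ≤ ((1 + d) * a) ^ q := by
          apply Real.rpow_le_rpow (by positivity) _ hq.le; linarith
      _ = (1 + d) ^ q * a ^ q := Real.mul_rpow (by positivity) ha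
      _ ≤ (1 + e) * a ^ q := by gcongr
      _ ≤ _ := by
          have : 0 ≤ (1 / d + 1) ^ q * b ^ q := by positivity
          linarith
  · have hab : a ≤ 1 / d * b := by
      rw [one_div, ← div_eq_inv_mul, le_div_iff₀ hd0]; linarith
    calc (a + b) ^ q ≤ ((1 / d + 1) * b) ^ q := by
          apply Real.rpow_le_rpow (by positivity) _ hq.le; linarith
      _ = (1 / d + 1) ^ q * b ^ q := Real.mul_rpow (by positivity) hb
      _ ≤ _ := by
          have : 0 ≤ (1 + e) * a ^ q := by positivity
          linarith

lemma bl_key' {q : ℝ} (hq : 0 < q) {e : ℝ} (he : 0 < e) :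
    ∃ C, 0 < C ∧ ∀ a b : ℝ, |(|a + b| ^ q - |a| ^ q)| ≤ e * |a| ^ q + C * |b| ^ q := by
  -- use parameter `min e 1 / 2`
  obtain ⟨C, hC, h⟩ := bl_key hq (e := min e 1 / 2) (by positivity)
  set d := min e 1 / 2 with hd
  have hd0 : 0 < d := by positivity
  have hd1 : d ≤ 1 := by have := min_le_right e 1; linarith
  have hde : 2 * d ≤ e := by have := min_le_left e 1; linarith
  refine ⟨2 * C, by positivity, fun a b => ?_⟩
  have ha : 0 ≤ |a| ^ q := by positivity
  have hb : 0 ≤ C * |b| ^ q := by positivity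
  have h1 : |a + b| ^ q ≤ (1 + d) * |a| ^ q + C * |b| ^ q :=
    (Real.rpow_le_rpow (abs_nonneg _) (abs_add_le a b) hq.le).trans
      (h _ _ (abs_nonneg _) (abs_nonneg _))
  have h2 : |a| ^ q ≤ (1 + d) * |a + b| ^ q + C * |b| ^ q := by
    have : |a| ≤ |a + b| + |b| := by
      have := abs_sub (a + b) b
      simpa using this
    exact (Real.rpow_le_rpow (abs_nonneg _) this hq.le).trans
      (h _ _ (abs_nonneg _) (abs_nonneg _))
  have h3 : d * |a + b| ^ q ≤ d * ((1 + d) * |a| ^ q + C * |b| ^ q) := by gcongr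
  have h4 : d * (d * |a| ^ q) ≤ d * |a| ^ q := by
    apply mul_le_mul_of_nonneg_left _ hd0.le
    nlinarith
  have h5 : d * (C * |b| ^ q) ≤ C * |b| ^ q := by nlinarith
  have h6 : 2 * d * |a| ^ q ≤ e * |a| ^ q := by gcongr
  rw [abs_le]
  constructor
  · nlinarith
  · nlinarith

/-- Brezis-Lieb lemma on the grid. -/
lemma brezis_lieb {q : ℝ} (hq : 0 < q) {F : ℕ → GX → ℝ} {f : GX → ℝ}
    (hFm : ∀ n, AEStronglyMeasurable (F n) gnu) (hfm : AEStronglyMeasurable f gnu)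
    (hF : ∀ n, Integrable (fun z => |F n z| ^ q) gnu) (hf : Integrable (fun z => |f z| ^ q) gnu)
    {B : ℝ} (hB : ∀ n, Mq q (F n) ≤ B) (hlim : ∀ z, Tendsto (fun n => F n z) atTop (𝓝 (f z))) :
    Tendsto (fun n => Mq q (F n) - Mq q (fun z => F n z - f z)) atTop (𝓝 (Mq q f)) := by
  have hdm : ∀ n, AEStronglyMeasurable (fun z => F n z - f z) gnu := fun n => (hFm n).sub hfm
  -- integrability of the difference
  obtain ⟨C1, hC1, hk1⟩ := bl_key' hq one_pos
  have hk2 : ∀ n z, |F n z - f z| ^ q ≤ 2 * |F n z| ^ q + C1 * |f z| ^ q := by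
    intro n z
    have := (abs_le.1 (hk1 (F n z) (-f z))).2
    rw [abs_neg, ← sub_eq_add_neg] at this
    linarith
  have hd : ∀ n, Integrable (fun z => |F n z - f z| ^ q) gnu := by
    intro n
    refine (((hF n).const_mul 2).add (hf.const_mul C1)).mono' (aesm_abs_rpow (hdm n) q)
      (ae_of_all _ fun z => ?_)
    rw [Real.norm_of_nonneg (by positivity)]
    exact hk2 n z
  set D := 2 * B + C1 * Mq q f with hD
  have hdB : ∀ n, Mq q (fun z => F n z - f z) ≤ D := by
    intro n
    have h1 : Mq q (fun z => F n z - f z) ≤ 2 * Mq q (F n) + C1 * Mq q f := by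
      unfold Mq
      rw [← integral_const_mul, ← integral_const_mul, ← integral_add ((hF n).const_mul 2)
        (hf.const_mul C1)]
      exact integral_mono (hd n) (((hF n).const_mul 2).add (hf.const_mul C1)) (hk2 n)
    have := hB n
    linarith
  have hD0 : 0 ≤ D := (Mq_nonneg _ _).trans (hdB 0)
  rw [Metric.tendsto_atTop]
  intro r hr
  set e := r / (2 * (D + 1)) with he
  have he0 : 0 < e := by positivity
  obtain ⟨C, hC, hk⟩ := bl_key' hq he0
  set W : ℕ → GX → ℝ := fun n z =>
    max (|(|F n z| ^ q - |F n z - f z| ^ q - |f z| ^ q)| - e * |F n z - f z| ^ q) 0 with hW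
  have hW0 : ∀ n z, 0 ≤ W n z := fun n z => le_max_right _ _
  have hWle : ∀ n z, W n z ≤ (1 + C) * |f z| ^ q := by
    intro n z
    refine max_le ?_ (by positivity)
    have h1 := hk (F n z - f z) (f z)
    rw [sub_add_cancel] at h1
    have h2 := abs_sub (|F n z| ^ q - |F n z - f z| ^ q) (|f z| ^ q)
    rw [abs_of_nonneg (by positivity : 0 ≤ |f z| ^ q)] at h2
    linarith
  have hX : ∀ n, Integrable (fun z => |F n z| ^ q - |F n z - f z| ^ q - |f z| ^ q) gnu :=
    fun n => ((hF n).sub (hd n)).sub hf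
  have hWi : ∀ n, Integrable (W n) gnu := fun n => ((hX n).abs.sub ((hd n).const_mul e)).pos_part
  have hWt : Tendsto (fun n => ∫ z, W n z ∂gnu) atTop (𝓝 (∫ _, (0:ℝ) ∂gnu)) := by
    refine tendsto_integral_of_dominated_convergence (fun z => (1 + C) * |f z| ^ q)
      (fun n => (hWi n).aestronglyMeasurable) (hf.const_mul _) (fun n => ae_of_all _ fun z => ?_)
      (ae_of_all _ fun z => ?_)
    · rw [Real.norm_of_nonneg (hW0 n z)]; exact hWle n z
    · have c1 : Tendsto (fun n => |F n z| ^ q) atTop (𝓝 (|f z| ^ q)) :=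
        (hlim z).abs.rpow_const (Or.inr hq.le)
      have c2 : Tendsto (fun n => |F n z - f z| ^ q) atTop (𝓝 0) := by
        have := (((hlim z).sub_const (f z)).abs).rpow_const (p := q) (Or.inr hq.le)
        simpa [Real.zero_rpow hq.ne'] using this
      have c3 := ((((c1.sub c2).sub_const (|f z| ^ q)).abs).sub (c2.const_mul e)).max
        (tendsto_const_nhds (x := (0:ℝ)))
      simpa using c3
  rw [integral_zero, Metric.tendsto_atTop] at hWt
  obtain ⟨N, hN⟩ := hWt (r / 2) (by positivity)
  refine ⟨N, fun n hn => ?_⟩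
  have h1 := hN n hn
  rw [Real.dist_eq, sub_zero] at h1
  have h1 := (abs_lt.1 h1).2
  rw [Real.dist_eq]
  have h2 : Mq q (F n) - Mq q (fun z => F n z - f z) - Mq q f =
      ∫ z, (|F n z| ^ q - |F n z - f z| ^ q - |f z| ^ q) ∂gnu := by
    unfold Mq
    rw [← integral_sub (hF n) (hd n), ← integral_sub _ hf]
    exact (hF n).sub (hd n)
  rw [h2]
  calc |∫ z, (|F n z| ^ q - |F n z - f z| ^ q - |f z| ^ q) ∂gnu|
      ≤ ∫ z, |(|F n z| ^ q - |F n z - f z| ^ q - |f z| ^ q)| ∂gnu := abs_integral_le_integral_abs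
    _ ≤ ∫ z, (W n z + e * |F n z - f z| ^ q) ∂gnu := by
        refine integral_mono (hX n).abs ((hWi n).add ((hd n).const_mul e)) fun z => ?_
        have : |(|F n z| ^ q - |F n z - f z| ^ q - |f z| ^ q)| - e * |F n z - f z| ^ q ≤ W n z :=
          le_max_left _ _
        simp only
        linarith
    _ = ∫ z, W n z ∂gnu + e * Mq q (fun z => F n z - f z) := by
        rw [integral_add (hWi n) ((hd n).const_mul e), integral_const_mul]; rfl
    _ < r / 2 + r / 2 := by
        have h3 : e * Mq q (fun z => F n z - f z) ≤ e * (D + 1) := by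
          gcongr
          have := hdB n
          linarith
        have h4 : e * (D + 1) = r / 2 := by
          rw [he]; field_simp
        linarith
    _ = r := by ring

/-- Fatou for masses. -/
lemma fatou_two {F : ℕ → GX → ℝ} {f : GX → ℝ} (hF : ∀ n, MemLp (F n) 2 gnu)
    (hfm : AEStronglyMeasurable f gnu) {B : ℝ} (hB : ∀ n, Mq 2 (F n) ≤ B)
    (hlim : ∀ z, Tendsto (fun n => F n z) atTop (𝓝 (f z))) : MemLp f 2 gnu := by
  rw [memLp_two_iff hfm]
  have h1 : ∀ z, ‖f z‖ₑ ^ (2:ℝ) = liminf (fun n => ‖F n z‖ₑ ^ (2:ℝ)) atTop := by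
    intro z
    have : Tendsto (fun n => ‖F n z‖ₑ ^ (2:ℝ)) atTop (𝓝 (‖f z‖ₑ ^ (2:ℝ))) :=
      ((ENNReal.continuous_rpow_const (y := 2)).tendsto _).comp (hlim z).enorm
    exact this.liminf_eq.symm
  simp_rw [h1]
  refine (lintegral_liminf_le' fun n => (hF n).1.enorm.pow_const _).trans_lt ?_
  refine lt_of_le_of_lt ?_ (ENNReal.ofReal_lt_top (r := B))
  refine liminf_le_of_le (by isBoundedDefault) fun b hb => ?_
  obtain ⟨n, hn⟩ := hb.exists
  rw [mem_Mq (hF n)] at hn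
  exact hn.trans (ENNReal.ofReal_le_ofReal (hB n))

end

open MeasureTheory Filter Topology
open scoped ENNReal NNReal

noncomputable section

lemma mul_integrable {f g : GX → ℝ} (hf : MemLp f 2 gnu) (hg : MemLp g 2 gnu) :
    Integrable (fun z => f z * g z) gnu := hf.integrable_mul hg

lemma weak_compact {G : ℕ → GX → ℝ} (hG : ∀ n, MemLp (G n) 2 gnu) {B : ℝ}
    (hB : ∀ n, Mq 2 (G n) ≤ B) : ∃ V, MemLp V 2 gnu ∧ ∃ φ : ℕ → ℕ, StrictMono φ ∧
      ∀ H, MemLp H 2 gnu → Tendsto (fun n => ∫ z, G (φ n) z * H z ∂gnu) atTop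
        (𝓝 (∫ z, V z * H z ∂gnu)) := by
  have : Fact ((1:ℝ≥0∞) ≤ 2) := ⟨by norm_num⟩
  have : Fact ((2:ℝ≥0∞) ≠ ⊤) := ⟨by norm_num⟩
  have hip : ∀ {f g : GX → ℝ} (hf : MemLp f 2 gnu) (hg : MemLp g 2 gnu),
      inner ℝ (hf.toLp f) (hg.toLp g) = ∫ z, f z * g z ∂gnu := by
    intro f g hf hg
    rw [L2.inner_def]
    refine integral_congr_ae ?_
    filter_upwards [hf.coeFn_toLp, hg.coeFn_toLp] with z h1 h2
    rw [h1, h2]; simp [mul_comm]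
  set E := Lp ℝ 2 gnu
  let g : ℕ → E := fun n => (hG n).toLp (G n)
  have hgn : ∀ n, ‖g n‖ ≤ √B := by
    intro n
    apply Real.le_sqrt_of_sq_le
    rw [← real_inner_self_eq_norm_sq, hip]
    refine le_trans (le_of_eq ?_) (hB n)
    rw [Mq_two]
    refine integral_congr_ae (ae_of_all _ fun z => ?_)
    simp only; ring
  let x : ℕ → WeakDual ℝ E := fun n =>
    StrongDual.toWeakDual (InnerProductSpace.toDual ℝ E (g n))
  have hx : ∀ n, x n ∈ WeakDual.toStrongDual ⁻¹' Metric.closedBall (0 : StrongDual ℝ E) (√B) := by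
    intro n
    rw [Set.mem_preimage, mem_closedBall_zero_iff]
    refine le_trans (le_of_eq ?_) (hgn n)
    exact (InnerProductSpace.toDual ℝ E).norm_map (g n)
  have hsep : TopologicalSpace.SeparableSpace E := inferInstance
  obtain ⟨a, -, φ, hφ, hlim⟩ := WeakDual.isSeqCompact_closedBall ℝ E 0 (√B) hx
  let v : E := (InnerProductSpace.toDual ℝ E).symm (WeakDual.toStrongDual a)
  refine ⟨v, Lp.memLp v, φ, hφ, fun H hH => ?_⟩
  have h1 := (tendsto_iff_forall_eval_tendsto_topDualPairing.1 hlim) (hH.toLp H)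
  have h2 : ∀ n, topDualPairing ℝ E ((x ∘ φ) n) (hH.toLp H) = ∫ z, G (φ n) z * H z ∂gnu := by
    intro n
    rw [← hip (hG (φ n)) hH]
    rfl
  have h3 : topDualPairing ℝ E a (hH.toLp H) = ∫ z, v z * H z ∂gnu := by
    have : inner ℝ v (hH.toLp H) = ∫ z, v z * H z ∂gnu := by
      have := hip (Lp.memLp v) hH
      rwa [Lp.toLp_coeFn] at this
    rw [← this, InnerProductSpace.toDual_symm_apply]
    rfl
  simpa only [h2, h3] using h1

lemma gnu_restrict (l : ℤ ⊕ ℤ) {s : Set ℝ} (hs : MeasurableSet s) :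
    gnu.restrict ({l} ×ˢ s) = Measure.map (Prod.mk l) (volume.restrict s) := by
  ext A hA
  have hm : MeasurableSet ({l} ×ˢ s : Set GX) := (measurableSet_singleton l).prod hs
  rw [Measure.restrict_apply hA, Measure.map_apply measurable_prodMk_left hA,
    Measure.restrict_apply (measurable_prodMk_left hA), ← lintegral_indicator_one (hA.inter hm),
    lintegral_gnu, tsum_eq_single l, ← lintegral_indicator_one ((measurable_prodMk_left hA).inter hs)]
  · refine lintegral_congr fun x => ?_
    have e : (l, x) ∈ A ∩ {l} ×ˢ s ↔ x ∈ Prod.mk l ⁻¹' A ∩ s := by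
      simp [Set.mem_inter_iff, Set.mem_prod]
    by_cases hc : x ∈ Prod.mk l ⁻¹' A ∩ s
    · rw [Set.indicator_of_mem hc, Set.indicator_of_mem (e.2 hc)]; rfl
    · rw [Set.indicator_of_notMem hc, Set.indicator_of_notMem fun h => hc (e.1 h)]
  · intro l' hl'
    simp [Set.indicator, hl']

lemma weak_line {G : ℕ → GX → ℝ} {V : GX → ℝ} {φ : ℕ → ℕ}
    (h : ∀ H, MemLp H 2 gnu → Tendsto (fun n => ∫ z, G (φ n) z * H z ∂gnu) atTop
        (𝓝 (∫ z, V z * H z ∂gnu))) (l : ℤ ⊕ ℤ) (a b : ℝ) :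
    Tendsto (fun n => ∫ t in a..b, G (φ n) (l, t)) atTop (𝓝 (∫ t in a..b, V (l, t))) := by
  have hs : ∀ a b : ℝ, Tendsto (fun n => ∫ t in Set.Ioc a b, G (φ n) (l, t)) atTop
      (𝓝 (∫ t in Set.Ioc a b, V (l, t))) := by
    intro a b
    have hm : MeasurableSet ({l} ×ˢ Set.Ioc a b : Set GX) :=
      (measurableSet_singleton l).prod measurableSet_Ioc
    have hfin : gnu ({l} ×ˢ Set.Ioc a b) ≠ ⊤ := by
      rw [← Measure.restrict_apply_univ, gnu_restrict l measurableSet_Ioc,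
        Measure.map_apply measurable_prodMk_left MeasurableSet.univ]
      simp
    have h1 := h _ (memLp_indicator_const (p := 2) (μ := gnu) hm (1:ℝ) (Or.inr hfin))
    have h2 : ∀ f : GX → ℝ, ∫ z, f z * (({l} ×ˢ Set.Ioc a b : Set GX).indicator (fun _ => (1:ℝ)) z) ∂gnu
        = ∫ t in Set.Ioc a b, f (l, t) := by
      intro f
      have : ∀ z, f z * (({l} ×ˢ Set.Ioc a b : Set GX).indicator (fun _ => (1:ℝ)) z) =
          ({l} ×ˢ Set.Ioc a b : Set GX).indicator f z := by
        intro z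
        by_cases hz : z ∈ ({l} ×ˢ Set.Ioc a b : Set GX)
        · rw [Set.indicator_of_mem hz, Set.indicator_of_mem hz, mul_one]
        · rw [Set.indicator_of_notMem hz, Set.indicator_of_notMem hz, mul_zero]
      simp_rw [this]
      rw [integral_indicator hm, gnu_restrict l measurableSet_Ioc,
        (measurableEmbedding_prodMk_left l).integral_map]
    simpa only [h2] using h1
  unfold intervalIntegral
  exact (hs a b).sub (hs b a)

/-- Extraction of a limit. -/
lemma extract {F G : ℕ → GX → ℝ} (hH : ∀ n, IsH1 (F n) (G n)) {A B d : ℝ}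
    (hA : ∀ n, Mq 2 (F n) ≤ A) (hB : ∀ n, Mq 2 (G n) ≤ B) (hd : 0 < d)
    (hx : ∀ n, ∃ x ∈ Set.Icc (0:ℝ) 1, d ≤ |F n (.inl 0, x)|) :
    ∃ f g, IsH1 f g ∧ f ≠ 0 ∧ ∃ φ : ℕ → ℕ, StrictMono φ ∧
      (∀ z, Tendsto (fun n => F (φ n) z) atTop (𝓝 (f z))) ∧
      (Tendsto (fun n => ∫ z, G (φ n) z * g z ∂gnu) atTop (𝓝 (∫ z, g z * g z ∂gnu))) := by
  obtain ⟨V, hV, φ, hφ, hw⟩ := weak_compact (fun n => (hH n).memG) hB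
  set S := √(2 * √(A * B)) with hS
  have hFS : ∀ n z, |F n z| ≤ S := by
    intro n z
    refine ((hH n).abs_le z).trans ?_
    unfold supB
    have := Mq_nonneg 2 (F n)
    have := Mq_nonneg 2 (G n)
    have h3 := hA n
    have h4 := hB n
    rw [hS]
    refine Real.sqrt_le_sqrt (mul_le_mul_of_nonneg_left (Real.sqrt_le_sqrt ?_) (by norm_num))
    exact mul_le_mul h3 h4 (Mq_nonneg _ _) (by linarith)
  choose x hx01 hxd using hx
  have hcomp : IsCompact ((Set.univ.pi fun _ : ℤ ⊕ ℤ => Set.Icc (-S) S) ×ˢ Set.Icc (0:ℝ) 1) :=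
    (isCompact_univ_pi fun _ => isCompact_Icc).prod isCompact_Icc
  obtain ⟨⟨c, xs⟩, hcx, ψ, hψ, hlim⟩ := hcomp.tendsto_subseq
    (x := fun n => ((fun l => F (φ n) (l, 0)), x (φ n))) (fun n => by
      refine ⟨fun l _ => abs_le.1 (hFS _ _), hx01 _⟩)
  rw [Prod.tendsto_iff] at hlim
  obtain ⟨hc, hxs⟩ := hlim
  rw [tendsto_pi_nhds] at hc
  set θ : ℕ → ℕ := φ ∘ ψ with hθ
  have hθm : StrictMono θ := hφ.comp hψ
  have hw' : ∀ H, MemLp H 2 gnu → Tendsto (fun n => ∫ z, G (θ n) z * H z ∂gnu) atTop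
        (𝓝 (∫ z, V z * H z ∂gnu)) := fun H hH => (hw H hH).comp hψ.tendsto_atTop
  have hVi : ∀ l a b, IntervalIntegrable (fun t => V (l, t)) volume a b := fun l a b =>
    (((line_memLp hV l).locallyIntegrable (by norm_num)).integrableOn_isCompact
      isCompact_uIcc).intervalIntegrable
  set f : GX → ℝ := fun z => c z.1 + ∫ t in (0:ℝ)..z.2, V (z.1, t) with hf
  have hpt : ∀ z, Tendsto (fun n => F (θ n) z) atTop (𝓝 (f z)) := by
    rintro ⟨l, y⟩
    have h1 := (hc l).add (weak_line hw' l 0 y)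
    refine h1.congr fun n => ?_
    rw [(hH _).ftc]
    simp [hθ]
  have hcont : ∀ l, Continuous fun y => f (l, y) := fun l =>
    (continuous_const (y := c l)).add (intervalIntegral.continuous_primitive (hVi l) 0)
  have hfm : AEStronglyMeasurable f gnu := aesm_of_meas fun l => (hcont l).measurable
  have hfg : IsH1 f V := by
    refine ⟨hcont, ?_, fatou_two (fun n => (hH (θ n)).memF) hfm (fun n => hA _) hpt, hV, ?_⟩
    · intro l a b
      have := intervalIntegral.integral_add_adjacent_intervals (hVi l 0 a) (hVi l a b)
      simp only [hf]
      linarith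
    · intro j k
      refine tendsto_nhds_unique (hpt _) ?_
      simp_rw [(hH _).compat]
      exact hpt _
  refine ⟨f, V, hfg, ?_, θ, hθm, hpt, hw' V hV⟩
  -- nontriviality
  intro hf0
  have hB0 : 0 ≤ B := (Mq_nonneg _ _).trans (hB 0)
  set η := d / (B + 1) with hη
  have hη0 : 0 < η := by positivity
  have hosc : ∀ n y, |F n (.inl 0, x n)| - |F n (.inl 0, y)| ≤ η * B / 2 + |y - x n| / (2 * η) := by
    intro n y
    have h1 : |F n (.inl 0, x n)| - |F n (.inl 0, y)| ≤ |F n (.inl 0, y) - F n (.inl 0, x n)| := by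
      rw [abs_sub_comm]
      exact abs_sub_abs_le_abs_sub _ _
    refine h1.trans ?_
    rw [← (hH n).ftc, ← Real.norm_eq_abs, intervalIntegral.norm_integral_eq_norm_integral_uIoc]
    refine (norm_integral_le_integral_norm _).trans ?_
    have hsq : Integrable (fun t => G n (.inl 0, t) ^ 2) := (line_memLp (hH n).memG _).integrable_sq
    have hvol : volume (Set.uIoc (x n) y) ≠ ⊤ := by simp [Set.uIoc]
    have h2 : ∫ t in Set.uIoc (x n) y, ‖G n (.inl 0, t)‖ ≤
        ∫ t in Set.uIoc (x n) y, (η / 2 * G n (.inl 0, t) ^ 2 + 1 / (2 * η)) := by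
      refine integral_mono ?_ ?_ fun t => ?_
      · exact (((hH n).intInt (.inl 0) (x n) y).def').norm
      · exact (hsq.restrict.const_mul _).add (integrable_const_iff.2 (Or.inr ⟨by simpa using hvol.lt_top⟩))
      · simp only [Real.norm_eq_abs]
        have : 0 ≤ (η * |G n (.inl 0, t)| - 1) ^ 2 / (2 * η) := by positivity
        have e : (η * |G n (.inl 0, t)| - 1) ^ 2 / (2 * η) =
          η / 2 * G n (.inl 0, t) ^ 2 + 1 / (2 * η) - |G n (.inl 0, t)| := by
          rw [← sq_abs (G n (.inl 0, t))]
          field_simp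
          ring
        linarith
    refine h2.trans ?_
    rw [integral_add (hsq.restrict.const_mul _)
      (integrable_const_iff.2 (Or.inr ⟨by simpa using hvol.lt_top⟩)), integral_const_mul,
      setIntegral_const]
    have h3 : ∫ t in Set.uIoc (x n) y, G n (.inl 0, t) ^ 2 ≤ B := by
      refine (setIntegral_le_integral hsq (ae_of_all _ fun t => sq_nonneg _)).trans ?_
      refine le_trans ?_ (hB n)
      rw [Mq_two, ← (measurableEmbedding_prodMk_left (Sum.inl 0 : ℤ ⊕ ℤ)).integral_map (fun z => G n z ^ 2)]
      refine integral_mono_measure (Measure.le_sum _ (Sum.inl 0)) (ae_of_all _ fun t => sq_nonneg _) ?_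
      exact (hH n).memG.integrable_sq
    have h4 : volume.real (Set.uIoc (x n) y) = |y - x n| := by
      rw [Measure.real, Real.volume_uIoc, ENNReal.toReal_ofReal (abs_nonneg _)]
    rw [h4, smul_eq_mul]
    have h5 : η / 2 * ∫ t in Set.uIoc (x n) y, G n (.inl 0, t) ^ 2 ≤ η / 2 * B := by gcongr
    have h6 : |y - x n| * (1 / (2 * η)) = |y - x n| / (2 * η) := by ring
    rw [h6]
    linarith
  have hl1 : Tendsto (fun n => |F (θ n) (.inl 0, xs)|) atTop (𝓝 0) := by
    have := (hpt (.inl 0, xs)).abs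
    rwa [hf0, Pi.zero_apply, abs_zero] at this
  have hl2 : Tendsto (fun n => η * B / 2 + |xs - x (θ n)| / (2 * η)) atTop (𝓝 (η * B / 2)) := by
    have h1 : Tendsto (fun n => x (θ n)) atTop (𝓝 xs) := hxs
    have h2 := (((tendsto_const_nhds (x := xs)).sub h1).abs.div_const (2 * η)).const_add (η * B / 2)
    simpa using h2
  have hl3 : d ≤ 0 + η * B / 2 := by
    refine ge_of_tendsto' (hl1.add hl2) fun n => ?_
    have := hosc (θ n) xs
    have := hxd (θ n)
    linarith
  have : η * B / 2 < d := by
    have h1 : η * (B + 1) = d := by rw [hη]; field_simp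
    nlinarith
  linarith

end

open MeasureTheory Filter Topology
open scoped ENNReal NNReal

noncomputable section

/-- Lower bound for the energy at smaller mass. -/
lemma scal {p μ e : ℝ} (hp : 2 < p) (hμ : 0 < μ) (he : e ≤ 0)
    (hE : ∀ F' G', IsH1 F' G' → Mq 2 F' = μ → e ≤ IE p F' G')
    {F G : GX → ℝ} (h : IsH1 F G) (hM : Mq 2 F ≤ μ) :
    e * (Mq 2 F / μ) ≤ IE p F G ∧
      (0 < Mq 2 F → Mq 2 F < μ → e * (Mq 2 F / μ) < IE p F G) := by
  rcases (Mq_nonneg 2 F).eq_or_lt with h0 | h0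
  · refine ⟨?_, fun h1 => absurd h0 h1.ne⟩
    have h1 := h.Mq_le hp.le
    rw [← h0, mul_zero] at h1
    rw [← h0, zero_div, mul_zero]
    unfold IE
    have h2 := Mq_nonneg 2 G
    have h3 : Mq p F = 0 := le_antisymm h1 (Mq_nonneg _ _)
    rw [h3]; linarith
  · obtain ⟨c, hc, hc2, hcH, hcM⟩ := h.normalize h0 hμ
    have h1 := hE _ _ hcH hcM
    have hP := h.pos_q h0 hp.le
    unfold IE at h1 ⊢
    rw [Mq_smul, Mq_smul, abs_of_pos hc, Real.rpow_two] at h1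
    have hcc : 1 ≤ c ^ 2 := by rw [hc2, le_div_iff₀ h0]; linarith
    have hc1 : 1 ≤ c := by
      by_contra hlt
      push Not at hlt
      nlinarith
    have hpow : c ^ 2 ≤ c ^ p := by
      rw [← Real.rpow_two]
      exact Real.rpow_le_rpow_of_exponent_le hc1 hp.le
    have hM2 : Mq 2 F / μ = (c ^ 2)⁻¹ := by rw [hc2, inv_div]
    rw [hM2, ← div_eq_mul_inv]
    constructor
    · rw [div_le_iff₀ (by positivity)]
      have : 1 / p * (c ^ 2 * Mq p F) ≤ 1 / p * (c ^ p * Mq p F) := by gcongr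
      linarith
    · intro _ hlt
      have hc1' : 1 < c := by
        have : 1 < c ^ 2 := by rw [hc2, lt_div_iff₀ h0]; linarith
        by_contra hlt
        push Not at hlt
        nlinarith
      have hpow : c ^ 2 < c ^ p := by
        rw [← Real.rpow_two]
        exact Real.rpow_lt_rpow_of_exponent_lt hc1' hp
      rw [div_lt_iff₀ (by positivity)]
      have : 1 / p * (c ^ 2 * Mq p F) < 1 / p * (c ^ p * Mq p F) := by gcongr
      linarith

lemma energy_split {F G f g : GX → ℝ} (h : IsH1 F G) (h' : IsH1 f g) :
    Mq 2 G - Mq 2 (fun z => G z - g z) = 2 * (∫ z, G z * g z ∂gnu) - ∫ z, g z * g z ∂gnu := by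
  have hs : Integrable (fun z => (G z - g z) ^ 2) gnu := (h.memG.sub h'.memG).integrable_sq
  rw [Mq_two, Mq_two, ← integral_sub h.memG.integrable_sq hs,
    ← integral_const_mul, ← integral_sub ((mul_integrable h.memG h'.memG).const_mul 2)
      (mul_integrable h'.memG h'.memG)]
  refine integral_congr_ae (ae_of_all _ fun z => ?_)
  ring

lemma compactness {p μ e B c : ℝ} (hp : 2 < p) (hμ : 0 < μ) (he : e ≤ 0)
    (hE : ∀ F' G', IsH1 F' G' → Mq 2 F' = μ → e ≤ IE p F' G')
    {F G : ℕ → GX → ℝ} (hH : ∀ n, IsH1 (F n) (G n)) (hM : ∀ n, Mq 2 (F n) = μ)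
    (hB : ∀ n, Mq 2 (G n) ≤ B) (hc : 0 < c) (hP : ∀ n, c ≤ Mq p (F n))
    (hlim : Tendsto (fun n => IE p (F n) (G n)) atTop (𝓝 e)) :
    ∃ f g, IsH1 f g ∧ Mq 2 f = μ ∧ IE p f g ≤ e := by
  have hp0 : 0 < p := by linarith
  set d : ℝ := (c / (2 * μ)) ^ (1 / (p - 2)) with hd
  have hd0 : 0 < d := by positivity
  have hdp : d ^ (p - 2) * μ < c := by
    rw [hd, ← Real.rpow_mul (by positivity), one_div_mul_cancel (by linarith), Real.rpow_one]
    field_simp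
    linarith
  have hz : ∀ n, ∃ z, d ≤ |F n z| := by
    intro n
    by_contra hcon
    push Not at hcon
    have h1 := Mq_le_of_bd (hH n).memF (fun z => (hcon z).le) hp.le
    rw [hM n] at h1
    linarith [hP n]
  choose z hz using hz
  have hmv := fun n => (hH n).move (z n)
  choose F' G' hH' hF' hG' hx using hmv
  have hM' : ∀ n, Mq 2 (F' n) = μ := fun n => by rw [hF' n 2 (by norm_num), hM]
  have hB' : ∀ n, Mq 2 (G' n) ≤ B := fun n => by rw [hG' n 2 (by norm_num)]; exact hB n
  have hlim' : Tendsto (fun n => IE p (F' n) (G' n)) atTop (𝓝 e) := by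
    refine hlim.congr fun n => ?_
    unfold IE
    rw [hF' n p hp0.le, hG' n 2 (by norm_num)]
  obtain ⟨f, g, hfg, hf0, φ, hφ, hpt, hg⟩ := extract hH' (fun n => (hM' n).le) hB' hd0
    (fun n => by
      obtain ⟨x, hx1, hx2⟩ := hx n
      exact ⟨x, hx1, by rw [hx2]; exact hz n⟩)
  have hbl2 := brezis_lieb (q := 2) (by norm_num) (fun n => (hH' (φ n)).memF.1) hfg.memF.1
    (fun n => (hH' (φ n)).integrable_q le_rfl) (hfg.integrable_q le_rfl)
    (fun n => (hM' (φ n)).le) hpt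
  have hPB : ∀ n, Mq p (F' n) ≤ (√(2 * √(μ * B))) ^ (p - 2) * μ := by
    intro n
    refine ((hH' n).Mq_le hp.le).trans ?_
    rw [hM' n]
    unfold supB
    rw [hM' n]
    have h4 := hB' n
    refine mul_le_mul_of_nonneg_right (Real.rpow_le_rpow (Real.sqrt_nonneg _) ?_ (by linarith)) hμ.le
    exact Real.sqrt_le_sqrt (mul_le_mul_of_nonneg_left (Real.sqrt_le_sqrt
      (mul_le_mul_of_nonneg_left h4 hμ.le)) (by norm_num))
  have hblp := brezis_lieb (q := p) hp0 (fun n => (hH' (φ n)).memF.1) hfg.memF.1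
    (fun n => (hH' (φ n)).integrable_q hp.le) (hfg.integrable_q hp.le)
    (fun n => hPB (φ n)) hpt
  have hT : Tendsto (fun n => Mq 2 (G' (φ n)) - Mq 2 (fun z => G' (φ n) z - g z)) atTop
      (𝓝 (Mq 2 g)) := by
    have h1 := (hg.const_mul 2).sub_const (∫ z, g z * g z ∂gnu)
    have h2 : 2 * (∫ z, g z * g z ∂gnu) - ∫ z, g z * g z ∂gnu = Mq 2 g := by
      rw [Mq_two]
      have : ∫ z, g z ^ 2 ∂gnu = ∫ z, g z * g z ∂gnu :=
        integral_congr_ae (ae_of_all _ fun z => by simp only; ring)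
      rw [this]; ring
    rw [h2] at h1
    exact h1.congr fun n => (energy_split (hH' (φ n)) hfg).symm
  simp only [hM'] at hbl2
  have hm0 : 0 < Mq 2 f := (hfg.pos hf0).1
  have hR : Tendsto (fun n => Mq 2 (fun z => F' (φ n) z - f z)) atTop (𝓝 (μ - Mq 2 f)) := by
    have := (tendsto_const_nhds (x := μ)).sub hbl2
    refine this.congr fun n => ?_
    ring
  have hmμ : Mq 2 f ≤ μ := by
    have := ge_of_tendsto' hR fun n => Mq_nonneg _ _
    linarith
  have hEn : Tendsto (fun n => IE p (fun z => F' (φ n) z - f z) (fun z => G' (φ n) z - g z)) atTop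
      (𝓝 (e - IE p f g)) := by
    have h1 := hlim'.comp hφ.tendsto_atTop
    have h2 := (hT.const_mul (1 / 2)).sub (hblp.const_mul (1 / p))
    refine (h1.sub h2).congr fun n => ?_
    simp only [Function.comp, IE]
    ring
  have hev : ∀ᶠ n in atTop, Mq 2 (fun z => F' (φ n) z - f z) ≤ μ := by
    have : μ - Mq 2 f < μ := by linarith
    filter_upwards [hR.eventually (gt_mem_nhds this)] with n hn using hn.le
  have hkey : e * ((μ - Mq 2 f) / μ) ≤ e - IE p f g := by
    refine le_of_tendsto_of_tendsto ((hR.div_const μ).const_mul e) hEn ?_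
    filter_upwards [hev] with n hn
    exact (scal hp hμ he hE ((hH' (φ n)).sub hfg) hn).1
  have hkey' : IE p f g ≤ e * (Mq 2 f / μ) := by
    have : e * ((μ - Mq 2 f) / μ) = e - e * (Mq 2 f / μ) := by field_simp
    linarith
  have hmeq : Mq 2 f = μ := by
    by_contra hne
    have := (scal hp hμ he hE hfg hmμ).2 hm0 (lt_of_le_of_ne hmμ hne)
    linarith
  refine ⟨f, g, hfg, hmeq, ?_⟩
  rwa [hmeq, div_self hμ.ne', mul_one] at hkey'

lemma sublin {C a : ℝ} (hC : 0 ≤ C) (ha : 0 < a) (ha1 : a < 1) :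
    ∃ B, ∀ T, 0 ≤ T → C * T ^ a ≤ T / 4 + B := by
  set T0 : ℝ := (4 * C) ^ (1 / (1 - a)) with hT0
  have hT00 : 0 ≤ T0 := by positivity
  refine ⟨C * T0 ^ a, fun T hT => ?_⟩
  rcases le_or_gt T T0 with h | h
  · have : C * T ^ a ≤ C * T0 ^ a := by gcongr
    linarith
  · have hTp : 0 < T := hT00.trans_lt h
    have h1 : 4 * C ≤ T ^ (1 - a) := by
      have : T0 ^ (1 - a) ≤ T ^ (1 - a) := Real.rpow_le_rpow hT00 h.le (by linarith)
      rwa [hT0, ← Real.rpow_mul (by positivity), one_div_mul_cancel (by linarith),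
        Real.rpow_one] at this
    have h2 : T ^ (1 - a) * T ^ a = T := by
      rw [← Real.rpow_add hTp]; simp
    have h3 : 4 * C * T ^ a ≤ T := by
      calc 4 * C * T ^ a ≤ T ^ (1 - a) * T ^ a := by gcongr
        _ = T := h2
    have : 0 ≤ C * T0 ^ a := by positivity
    linarith

lemma supB_rpow (F G : GX → ℝ) (r : ℝ) :
    supB F G ^ r = (4 * (Mq 2 F * Mq 2 G)) ^ (r / 4) := by
  have h0 : 0 ≤ Mq 2 F * Mq 2 G := mul_nonneg (Mq_nonneg _ _) (Mq_nonneg _ _)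
  have h1 : 2 * √(Mq 2 F * Mq 2 G) = √(4 * (Mq 2 F * Mq 2 G)) := by
    rw [show (4:ℝ) = 2 ^ 2 by norm_num, Real.sqrt_mul (x := (2:ℝ) ^ 2) (by norm_num),
      Real.sqrt_sq (by norm_num)]
  unfold supB
  rw [h1, Real.sqrt_eq_rpow, Real.sqrt_eq_rpow, ← Real.rpow_mul (by positivity),
    ← Real.rpow_mul (by positivity)]
  congr 1
  ring

/-- One-dimensional type Gagliardo–Nirenberg bound at fixed mass. -/
lemma bound_one {p μ : ℝ} (hp : 2 ≤ p) (hμ : 0 < μ) {F G : GX → ℝ} (h : IsH1 F G)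
    (hM : Mq 2 F = μ) :
    Mq p F ≤ ((4 * μ) ^ ((p - 2) / 4) * μ) * Mq 2 G ^ ((p - 2) / 4) := by
  have h1 := h.Mq_le hp
  rw [supB_rpow, hM, ← mul_assoc, Real.mul_rpow (by positivity) (Mq_nonneg _ _)] at h1
  linarith

lemma bound_two {p μ : ℝ} (hp : 4 ≤ p) {F G : GX → ℝ} (h : IsH1 F G)
    (hM : Mq 2 F = μ) :
    Mq p F ≤ (4 * (μ * Mq 2 G)) ^ ((p - 4) / 4) * (4 * (μ * Mq 2 G)) := by
  have h1 := h.Mq_le4 hp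
  rwa [supB_rpow, hM] at h1

lemma coercive {p μ : ℝ} (hp4 : 4 < p) (hp6 : p < 6) (hμ : 0 < μ) :
    ∃ B, ∀ F G, IsH1 F G → Mq 2 F = μ → Mq 2 G / 4 - B ≤ IE p F G := by
  obtain ⟨B, hB⟩ := sublin (C := 1 / p * ((4 * μ) ^ ((p - 2) / 4) * μ)) (a := (p - 2) / 4)
    (by positivity) (by linarith) (by linarith)
  refine ⟨B, fun F G h hM => ?_⟩
  have h1 := bound_one (by linarith : (2:ℝ) ≤ p) hμ h hM
  have h2 := hB (Mq 2 G) (Mq_nonneg _ _)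
  have h3 : 1 / p * Mq p F ≤ 1 / p * (((4 * μ) ^ ((p - 2) / 4) * μ) * Mq 2 G ^ ((p - 2) / 4)) := by
    gcongr
  unfold IE
  linarith

lemma gn_ineq {p K : ℝ} (hK : IsLUB (gnS p) K) {F G : GX → ℝ} (h : IsH1 F G) (h0 : 0 < Mq 2 F) :
    Mq p F ≤ K * Mq 2 F ^ ((p - 2) / 2) * Mq 2 G := by
  have hne := h.ne_zero h0
  have hT := (h.pos hne).2
  have := hK.1 ⟨F, G, h, hne, rfl⟩
  rw [div_le_iff₀ (by positivity)] at this
  linarith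

lemma K_pos {p K : ℝ} (hp : 2 ≤ p) (hK : IsLUB (gnS p) K) : 0 < K := by
  obtain ⟨F, G, h, hM, hT⟩ := exists_test one_pos one_pos
  have h0 : 0 < Mq 2 F := by rw [hM]; exact one_pos
  have hP := h.pos_q h0 hp
  have h1 := gn_ineq hK h h0
  rw [hM, hT, Real.one_rpow] at h1
  linarith

/-- A maximizing sequence at fixed mass. -/
lemma max_seq {p K μ : ℝ} (hp : 2 < p) (hK : IsLUB (gnS p) K) (hμ : 0 < μ) {q : ℝ} (hq : q < K) :
    ∃ F G, IsH1 F G ∧ Mq 2 F = μ ∧ 0 < Mq 2 G ∧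
      q * (μ ^ ((p - 2) / 2) * Mq 2 G) ≤ Mq p F := by
  obtain ⟨r, ⟨F, G, h, hne, rfl⟩, hr, -⟩ := hK.exists_between hq
  obtain ⟨h0, hT⟩ := h.pos hne
  obtain ⟨c, hc, hc2, hcH, hcM⟩ := h.normalize h0 hμ
  have hcM' := hcM
  rw [Mq_smul, abs_of_pos hc, Real.rpow_two] at hcM'
  refine ⟨_, _, hcH, hcM, ?_, ?_⟩
  · rw [Mq_smul, abs_of_pos hc]; positivity
  · rw [Mq_smul, Mq_smul, abs_of_pos hc, Real.rpow_two, ← hcM',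
      Real.mul_rpow (by positivity) (by positivity), ← Real.rpow_natCast c 2, ← Real.rpow_mul hc.le]
    rw [lt_div_iff₀ (by positivity)] at hr
    have e1 : c ^ p = c ^ ((2:ℕ) * ((p - 2) / 2) : ℝ) * c ^ ((2:ℕ) : ℝ) := by
      rw [← Real.rpow_add hc]; congr 1; push_cast; ring
    rw [e1]
    have h2 : 0 < c ^ ((2:ℕ) * ((p - 2) / 2) : ℝ) * c ^ ((2:ℕ) : ℝ) := by positivity
    have := mul_le_mul_of_nonneg_left hr.le h2.le
    calc _ = c ^ ((2:ℕ) * ((p - 2) / 2) : ℝ) * c ^ ((2:ℕ) : ℝ) * (q * (Mq 2 F ^ ((p - 2) / 2) * Mq 2 G)) := by ring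
      _ ≤ _ := this

lemma small_energy {p μ : ℝ} (hp : 2 < p) (hμ : 0 < μ) {ε : ℝ} (hε : 0 < ε) :
    ∃ F G, IsH1 F G ∧ Mq 2 F = μ ∧ IE p F G < ε := by
  obtain ⟨F, G, h, hM, hT⟩ := exists_test hμ (e := √(ε / μ)) (by positivity)
  refine ⟨F, G, h, hM, ?_⟩
  unfold IE
  rw [hT, Real.sq_sqrt (by positivity), div_mul_cancel₀ _ hμ.ne']
  have : 0 ≤ 1 / p * Mq p F := by
    have := Mq_nonneg p F
    positivity
  linarith

lemma main_gs {p K μ : ℝ} (hp4 : 4 < p) (hp6 : p < 6) (hK : IsLUB (gnS p) K) (hμ : 0 < μ)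
    (hcr : p / 2 ≤ K * μ ^ ((p - 2) / 2)) : ∃ F G, IsGS p μ F G := by
  have hK0 := K_pos (by linarith) hK
  obtain ⟨B, hB⟩ := coercive hp4 hp6 hμ
  set ES : Set ℝ := {e | ∃ F G, IsH1 F G ∧ Mq 2 F = μ ∧ IE p F G = e} with hES
  have hne : ES.Nonempty := by
    obtain ⟨F, G, h, hM, -⟩ := small_energy (p := p) (by linarith) hμ one_pos
    exact ⟨_, F, G, h, hM, rfl⟩
  have hbb : BddBelow ES := by
    refine ⟨-B, ?_⟩
    rintro _ ⟨F, G, h, hM, rfl⟩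
    have := hB F G h hM
    have := Mq_nonneg 2 G
    linarith
  set e := sInf ES with he
  have hE : ∀ F' G', IsH1 F' G' → Mq 2 F' = μ → e ≤ IE p F' G' := fun F' G' h hM =>
    csInf_le hbb ⟨F', G', h, hM, rfl⟩
  have he0 : e ≤ 0 := by
    refine le_of_forall_pos_lt_add fun ε hε => ?_
    obtain ⟨F, G, h, hM, hlt⟩ := small_energy (p := p) (by linarith) hμ hε
    rw [zero_add]
    exact (hE F G h hM).trans_lt hlt
  suffices hs : ∃ f g, IsH1 f g ∧ Mq 2 f = μ ∧ IE p f g ≤ e by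
    obtain ⟨f, g, h, hM, hle⟩ := hs
    exact ⟨f, g, h, hM, fun F' G' h' hM' => hle.trans (hE F' G' h' hM')⟩
  rcases he0.lt_or_eq with hneg | hzero
  · -- negative energy level
    have hseq : ∀ n : ℕ, ∃ F G, IsH1 F G ∧ Mq 2 F = μ ∧ IE p F G < e + (-e / 2) * (1 / ((n:ℝ) + 1)) := by
      intro n
      have hpos : 0 < (-e / 2) * (1 / ((n:ℝ) + 1)) := by
        have : 0 < -e := by linarith
        positivity
      obtain ⟨_, ⟨F, G, h, hM, rfl⟩, hlt⟩ := exists_lt_of_csInf_lt hne (lt_add_of_pos_right e hpos)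
      exact ⟨F, G, h, hM, hlt⟩
    choose F G hH hM hlt using hseq
    have hlt2 : ∀ n, IE p (F n) (G n) < e / 2 := by
      intro n
      have h1 : 1 / ((n:ℝ) + 1) ≤ 1 := by
        rw [div_le_one (by positivity)]
        have : (0:ℝ) ≤ n := Nat.cast_nonneg n
        linarith
      have : (-e / 2) * (1 / ((n:ℝ) + 1)) ≤ (-e / 2) * 1 :=
        mul_le_mul_of_nonneg_left h1 (by linarith)
      linarith [hlt n]
    refine compactness (B := 4 * B) (c := p * (-e / 2)) (by linarith) hμ he0 hE hH hM ?_
      (mul_pos (by linarith) (by linarith)) ?_ ?_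
    · intro n
      have := hB _ _ (hH n) (hM n)
      linarith [hlt2 n]
    · intro n
      have h1 := hlt2 n
      unfold IE at h1
      have h2 := Mq_nonneg 2 (G n)
      have h3 : -e / 2 ≤ 1 / p * Mq p (F n) := by linarith
      have h4 := mul_le_mul_of_nonneg_left h3 (by linarith : (0:ℝ) ≤ p)
      rwa [← mul_assoc, mul_one_div_cancel (by linarith : p ≠ 0), one_mul] at h4
    · refine tendsto_of_tendsto_of_tendsto_of_le_of_le tendsto_const_nhds ?_
        (fun n => hE _ _ (hH n) (hM n)) (fun n => (hlt n).le)
      have := (tendsto_one_div_add_atTop_nhds_zero_nat (𝕜 := ℝ)).const_mul (-e / 2)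
      simpa using this.const_add e
  · -- zero energy level
    have hseq : ∀ n : ℕ, ∃ F G, IsH1 F G ∧ Mq 2 F = μ ∧ 0 < Mq 2 G ∧
        K * (1 - 1 / 2 * (1 / ((n:ℝ) + 1))) * (μ ^ ((p - 2) / 2) * Mq 2 G) ≤ Mq p F := by
      intro n
      refine max_seq (by linarith) hK hμ ?_
      have : 0 < K * (1 / 2 * (1 / ((n:ℝ) + 1))) := by positivity
      linarith
    choose F G hH hM hT hQ using hseq
    set M := μ ^ ((p - 2) / 2) with hMdef
    have hM0 : 0 < M := by positivity
    have hle : ∀ n : ℕ, 1 / ((n:ℝ) + 1) ≤ 1 := by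
      intro n
      rw [div_le_one (by positivity)]
      have : (0:ℝ) ≤ n := Nat.cast_nonneg n
      linarith
    set D := K / 2 * M with hD
    have hD0 : 0 < D := by positivity
    have hDT : ∀ n, D * Mq 2 (G n) ≤ Mq p (F n) := by
      intro n
      refine le_trans ?_ (hQ n)
      have h1 : 0 < M * Mq 2 (G n) := mul_pos hM0 (hT n)
      have h2 : K / 2 ≤ K * (1 - 1 / 2 * (1 / ((n:ℝ) + 1))) := by
        have := hle n
        nlinarith
      have := mul_le_mul_of_nonneg_right h2 h1.le
      rw [hD]; linarith
    obtain ⟨B1, hB1⟩ := sublin (C := ((4 * μ) ^ ((p - 2) / 4) * μ) / D) (a := (p - 2) / 4)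
      (by positivity) (by linarith) (by linarith)
    have hTB : ∀ n, Mq 2 (G n) ≤ 4 / 3 * B1 := by
      intro n
      have h1 := (hDT n).trans (bound_one (by linarith) hμ (hH n) (hM n))
      have h2 := hB1 _ (hT n).le
      rw [div_mul_eq_mul_div] at h2
      have h3 : Mq 2 (G n) ≤ ((4 * μ) ^ ((p - 2) / 4) * μ) * Mq 2 (G n) ^ ((p - 2) / 4) / D := by
        rw [le_div_iff₀ hD0]; linarith
      linarith
    set T1 := (D / (4 * μ)) ^ (4 / (p - 4)) / (4 * μ) with hT1
    have hT10 : 0 < T1 := by positivity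
    have hTl : ∀ n, T1 ≤ Mq 2 (G n) := by
      intro n
      have h1 := (hDT n).trans (bound_two hp4.le (hH n) (hM n))
      have hTn := hT n
      have h2 : D / (4 * μ) ≤ (4 * (μ * Mq 2 (G n))) ^ ((p - 4) / 4) := by
        rw [div_le_iff₀ (by positivity)]
        refine le_of_mul_le_mul_right ?_ hTn
        linarith
      have h3 : (D / (4 * μ)) ^ (4 / (p - 4)) ≤ 4 * (μ * Mq 2 (G n)) := by
        have := Real.rpow_le_rpow (by positivity) h2 (by
          have : 0 < p - 4 := by linarith
          positivity : 0 ≤ 4 / (p - 4))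
        rwa [← Real.rpow_mul (by positivity),
          div_mul_div_cancel₀ (by norm_num : (4:ℝ) ≠ 0), div_self (by linarith : p - 4 ≠ 0),
          Real.rpow_one] at this
      rw [hT1, div_le_iff₀ (by positivity)]
      linarith
    refine compactness (B := 4 / 3 * B1) (c := D * T1) (by linarith) hμ he0 hE hH hM hTB
      (by positivity) (fun n => (mul_le_mul_of_nonneg_left (hTl n) hD0.le).trans (hDT n)) ?_
    rw [hzero]
    rw [hzero] at hE
    refine tendsto_of_tendsto_of_tendsto_of_le_of_le (g := fun _ => (0:ℝ))
      (h := fun n : ℕ => 1 / 4 * (4 / 3 * B1) * (1 / ((n:ℝ) + 1))) tendsto_const_nhds ?_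
        (fun n => hE _ _ (hH n) (hM n)) (fun n => ?_)
    · have := (tendsto_one_div_add_atTop_nhds_zero_nat (𝕜 := ℝ)).const_mul (1 / 4 * (4 / 3 * B1))
      simpa using this
    · simp only
      have hr0 : 0 ≤ 1 / ((n:ℝ) + 1) := by positivity
      have hr1 := hle n
      have h1 := hQ n
      have hTn := hT n
      have hTBn := hTB n
      generalize 1 / ((n:ℝ) + 1) = r at *
      have h2 : p / 2 * (1 - 1 / 2 * r) * Mq 2 (G n) ≤ Mq p (F n) := by
        refine le_trans ?_ h1
        have : p / 2 * ((1 - 1 / 2 * r) * Mq 2 (G n)) ≤ K * M * ((1 - 1 / 2 * r) * Mq 2 (G n)) :=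
          mul_le_mul_of_nonneg_right hcr (mul_nonneg (by linarith) hTn.le)
        linarith
      have h3 := mul_le_mul_of_nonneg_left h2 (by positivity : (0:ℝ) ≤ 1 / p)
      have h4 : 1 / p * (p / 2 * (1 - 1 / 2 * r) * Mq 2 (G n)) =
          1 / 2 * (1 - 1 / 2 * r) * Mq 2 (G n) := by
        field_simp
      rw [h4] at h3
      have h5 := mul_le_mul_of_nonneg_right hTBn hr0
      unfold IE
      linarith

lemma energy_ge {p K μ : ℝ} (hp : 0 < p) (hK : IsLUB (gnS p) K) (hμ : 0 < μ) {F G : GX → ℝ}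
    (h : IsH1 F G) (hM : Mq 2 F = μ) :
    1 / p * (p / 2 - K * μ ^ ((p - 2) / 2)) * Mq 2 G ≤ IE p F G := by
  have h1 := gn_ineq hK h (by rw [hM]; exact hμ)
  rw [hM] at h1
  have h2 := mul_le_mul_of_nonneg_left h1 (by positivity : (0:ℝ) ≤ 1 / p)
  unfold IE
  have : 1 / p * (p / 2 - K * μ ^ ((p - 2) / 2)) * Mq 2 G =
      1 / 2 * Mq 2 G - 1 / p * (K * μ ^ ((p - 2) / 2) * Mq 2 G) := by field_simp
  linarith

lemma crit_le {p K μ : ℝ} (hp : 2 < p) (hK : 0 < K) (hμ : 0 < μ) :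
    critMass p K ≤ μ ↔ p / 2 ≤ K * μ ^ ((p - 2) / 2) := by
  unfold critMass
  rw [show 2 / (p - 2) = ((p - 2) / 2)⁻¹ by rw [inv_div],
    Real.rpow_inv_le_iff_of_pos (by positivity) hμ.le (by linarith),
    div_le_iff₀ (by positivity), div_le_iff₀ (by positivity)]
  constructor <;> intro h <;> linarith

lemma crit_eq {p K : ℝ} (hp : 2 < p) (hK : 0 < K) :
    K * (critMass p K) ^ ((p - 2) / 2) = p / 2 := by
  unfold critMass
  rw [← Real.rpow_mul (by positivity), show 2 / (p - 2) * ((p - 2) / 2) = 1 by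
      have : p - 2 ≠ 0 := by linarith
      field_simp, Real.rpow_one]
  field_simp

end

noncomputable section

/-- **Dimensional crossover, part (i) (Theorem 1.2(i))**: for `p ∈ (4,6)` and
`μ > 0`, with `K_p` the optimal Gagliardo–Nirenberg constant and
`μ_p = (p/(2K_p))^{2/(p−2)}` the critical mass, a ground state of mass `μ`
exists if and only if `μ ≥ μ_p`; in particular at `μ = μ_p` a ground state
exists and has zero energy. -/
theorem grid_crossover_i (p K μ : ℝ) (hp₄ : 4 < p) (hp₆ : p < 6)
    (hK : IsLUB (gnSet p) K) (hμ : 0 < μ) :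
    ((∃ u : GridFunc, IsGroundState p μ u) ↔ critMass p K ≤ μ) ∧
    (μ = critMass p K →
      ∃ u : GridFunc, IsGroundState p μ u ∧ u.energy p = 0) := by
  have hp0 : 0 < p := by linarith
  rw [gnSet_eq hp0.le] at hK
  have hK0 := K_pos (by linarith) hK
  refine ⟨⟨?_, fun h => ?_⟩, fun h => ?_⟩
  · rintro ⟨u, hu⟩
    obtain ⟨h, hM, hmin⟩ := gs_of hp0.le hu
    rw [crit_le (by linarith) hK0 hμ]
    by_contra hcon
    push Not at hcon
    have h0 : 0 < Mq 2 (glue u.h u.w) := by rw [hM]; exact hμ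
    have hT := (h.pos (h.ne_zero h0)).2
    have h1 := energy_ge hp0 hK hμ h hM
    have h2 : 0 < 1 / p * (p / 2 - K * μ ^ ((p - 2) / 2)) * Mq 2 (glue u.hd u.wd) :=
      mul_pos (mul_pos (by positivity) (by linarith)) hT
    obtain ⟨F, G, hF, hFM, hlt⟩ := small_energy (p := p) (by linarith) hμ (h2.trans_le h1)
    exact absurd (hmin F G hF hFM) (not_le.2 hlt)
  · obtain ⟨F, G, hg⟩ := main_gs hp₄ hp₆ hK hμ ((crit_le (by linarith) hK0 hμ).1 h)
    obtain ⟨u, hu, -⟩ := of_gs hp0.le hg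
    exact ⟨u, hu⟩
  · have hc : K * μ ^ ((p - 2) / 2) = p / 2 := by rw [h]; exact crit_eq (by linarith) hK0
    obtain ⟨F, G, hg⟩ := main_gs hp₄ hp₆ hK hμ hc.ge
    obtain ⟨u, hu, hue⟩ := of_gs hp0.le hg
    refine ⟨u, hu, ?_⟩
    rw [hue]
    refine le_antisymm ?_ ?_
    · refine le_of_forall_pos_lt_add fun ε hε => ?_
      obtain ⟨F', G', h', hM', hlt⟩ := small_energy (p := p) (by linarith) hμ hε
      rw [zero_add]
      exact (hg.2.2 F' G' h' hM').trans_lt hlt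
    · have := energy_ge hp0 hK hμ hg.1 hg.2.1
      rw [hc] at this
      simpa using this

end
end

section
/- Dimensional crossover, part (ii) (Theorem 1.2(ii)): for p = 4 and μ > 0, a ground state of mass μ on the grid 𝒢 exists whenever μ > μ_4, and no ground state of mass μ exists whenever μ < μ_4. -/
/- Formalization of NLS ground states on the two-dimensional grid 𝒢
   (the planar metric graph with vertex set ℤ×ℤ and unit edges).

   A function `u` on 𝒢 is encoded by the family `h j` of its restrictions to
   the horizontal lines `H j` and the family `w k` of its restrictions to the
   vertical lines `V k`, subject to the vertex-compatibility conditions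
   `h j k = w k j`.  The (weak) derivative of `u` along each line is carried
   as additional data `hd`, `wd`, tied to `h`, `w` by the fundamental theorem
   of calculus in the membership predicates below. -/

open MeasureTheory Filter Topology
open scoped ENNReal NNReal

open MeasureTheory Filter Topology
open scoped ENNReal NNReal
noncomputable section
namespace GridAux

/-- index set of the lines: `(false, j)` is horizontal, `(true, k)` vertical. -/
abbrev Ln := Bool × ℤ

/-- The disjoint union of all lines. -/
abbrev Om := Ln × ℝ

/-- The natural measure on the disjoint union of the lines. -/
def nu : Measure Om := Measure.sum fun i : Ln => (volume : Measure ℝ).map (Prod.mk i)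

lemma emb (i : Ln) : MeasurableEmbedding (Prod.mk i : ℝ → Om) :=
  measurableEmbedding_prodMk_left i

instance : SFinite nu := by
  unfold nu
  infer_instance

lemma lintegral_nu (f : Om → ℝ≥0∞) : ∫⁻ z, f z ∂nu = ∑' i, ∫⁻ x, f (i, x) := by
  unfold nu
  rw [lintegral_sum_measure]
  congr 1; ext i
  rw [(emb i).lintegral_map]

lemma aesm_nu {f : Om → ℝ} :
    AEStronglyMeasurable f nu ↔ ∀ i, AEStronglyMeasurable (fun x => f (i, x)) volume := by
  unfold nu
  rw [aestronglyMeasurable_sum_measure_iff]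
  refine forall_congr' fun i => ?_
  rw [(emb i).aestronglyMeasurable_map_iff]
  rfl

lemma nu_apply {s : Set Om} (hs : MeasurableSet s) :
    nu s = ∑' i, volume (Prod.mk i ⁻¹' s) := by
  unfold nu
  rw [Measure.sum_apply _ hs]
  congr 1; ext i
  rw [(emb i).map_apply]

lemma map_le_nu (i : Ln) : (volume : Measure ℝ).map (Prod.mk i) ≤ nu :=
  Measure.le_sum _ i

lemma ae_nu {P : Om → Prop} (h : ∀ᵐ z ∂nu, P z) (i : Ln) : ∀ᵐ x : ℝ, P (i, x) :=
  (emb i).ae_map_iff.1 (ae_mono (map_le_nu i) h)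

lemma integrable_line {f : Om → ℝ} (h : Integrable f nu) (i : Ln) :
    Integrable (fun x => f (i, x)) := 
  (emb i).integrable_map_iff.1 (h.mono_measure (map_le_nu i))

lemma memLp_line {f : Om → ℝ} {p : ℝ≥0∞} (h : MemLp f p nu) (i : Ln) :
    MemLp (fun x => f (i, x)) p :=
  (emb i).memLp_map_measure_iff.1 (h.mono_measure (map_le_nu i))

lemma integral_line_le {f : Om → ℝ} (h : Integrable f nu) (h0 : ∀ z, 0 ≤ f z) (i : Ln) :
    ∫ x, f (i, x) ≤ ∫ z, f z ∂nu := by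
  rw [← (emb i).integral_map]
  exact integral_mono_measure (map_le_nu i) (ae_of_all _ h0) h

lemma integral_slab {g : Om → ℝ} (i : Ln) (A : Set ℝ) (hA : MeasurableSet A) :
    ∫ z in ({i} ×ˢ A : Set Om), g z ∂nu = ∫ x in A, g (i, x) := by
  have h1 : nu.restrict ({i} ×ˢ A : Set Om) = (volume.restrict A).map (Prod.mk i) := by
    ext s hs
    rw [Measure.restrict_apply hs, (emb i).map_apply, Measure.restrict_apply ((emb i).measurable hs),
      nu_apply (hs.inter ((measurableSet_singleton i).prod hA)), tsum_eq_single i]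
    · congr 1; ext x; simp
    · intro b hb
      have : (Prod.mk b ⁻¹' (s ∩ {i} ×ˢ A) : Set ℝ) = ∅ := by
        ext x; simp [hb]
      rw [this]; simp
  rw [h1, (emb i).integral_map]

lemma nu_slab (i : Ln) (A : Set ℝ) (hA : MeasurableSet A) :
    nu ({i} ×ˢ A : Set Om) = volume A := by
  rw [nu_apply ((measurableSet_singleton i).prod hA), tsum_eq_single i]
  · congr 1; ext x; simp
  · intro b hb
    have : (Prod.mk b ⁻¹' ({i} ×ˢ A) : Set ℝ) = ∅ := by
      ext x; simp [hb]
    rw [this]; simp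

/-- Weak sequential compactness in `L²(nu)`. -/
lemma weak_compact (d : ℕ → Om → ℝ) (C : ℝ) (hd : ∀ n, MemLp (d n) 2 nu)
    (hC : ∀ n, ∫ z, d n z ^ 2 ∂nu ≤ C) :
    ∃ (φ : ℕ → ℕ) (D : Om → ℝ), StrictMono φ ∧ MemLp D 2 nu ∧
      ∀ g : Om → ℝ, MemLp g 2 nu →
        Tendsto (fun n => ∫ z, d (φ n) z * g z ∂nu) atTop (𝓝 (∫ z, D z * g z ∂nu)) := by
  let X := Lp ℝ 2 nu
  haveI : Fact ((2:ℝ≥0∞) ≠ ∞) := ⟨by simp⟩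
  haveI : Fact ((1:ℝ≥0∞) ≤ 2) := ⟨by norm_num⟩
  have inner_eq : ∀ (f g : Om → ℝ) (hf : MemLp f 2 nu) (hg : MemLp g 2 nu),
      inner ℝ (hf.toLp f) (hg.toLp g) = ∫ z, f z * g z ∂nu := by
    intro f g hf hg
    rw [L2.inner_def]
    refine integral_congr_ae ?_
    filter_upwards [hf.coeFn_toLp, hg.coeFn_toLp] with z h1 h2
    rw [h1, h2]; simp [mul_comm]
  let x : ℕ → X := fun n => (hd n).toLp (d n)
  have hx : ∀ n, ‖x n‖ ≤ Real.sqrt C := by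
    intro n
    apply Real.le_sqrt_of_sq_le
    rw [← real_inner_self_eq_norm_sq]
    refine le_trans (le_of_eq ?_) (hC n)
    rw [inner_eq]
    congr 1; ext z; ring
  let ψ : ℕ → WeakDual ℝ X := fun n => StrongDual.toWeakDual (InnerProductSpace.toDual ℝ X (x n))
  obtain ⟨L, -, φ, hφ, hL⟩ := (WeakDual.isSeqCompact_closedBall ℝ X 0 (Real.sqrt C)) (x := ψ) (by
    intro n
    simp only [Set.mem_preimage, ψ]
    simpa using hx n)
  let D : X := (InnerProductSpace.toDual ℝ X).symm (WeakDual.toStrongDual L)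
  refine ⟨φ, D, hφ, Lp.memLp D, ?_⟩
  intro g hg
  have h1 := (WeakDual.eval_continuous (𝕜 := ℝ) (hg.toLp g)).seqContinuous hL
  have h2 : L (hg.toLp g) = ∫ z, D z * g z ∂nu := by
    have : L (hg.toLp g) = inner ℝ D (hg.toLp g) := by
      simp only [D]
      rw [InnerProductSpace.toDual_symm_apply]
      rfl
    rw [this]
    have := inner_eq D g (Lp.memLp D) hg
    rwa [Lp.toLp_coeFn] at this
  rw [← h2]
  refine h1.congr fun n => ?_
  simp only [Function.comp, ψ]
  rw [← inner_eq _ _ (hd (φ n)) hg]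
  rfl

end GridAux
end

open MeasureTheory Filter Topology
open scoped ENNReal NNReal
noncomputable section
namespace GridAux

/-- `f` is an `H¹` function on the grid with derivative `d`. -/
structure Good (f d : Om → ℝ) : Prop where
  cont : ∀ i, Continuous fun x => f (i, x)
  mf : MemLp f 2 nu
  md : MemLp d 2 nu
  ftc : ∀ i x, (∫ t in (0:ℝ)..x, d (i, t)) = f (i, x) - f (i, 0)
  compat : ∀ j k : ℤ, f ((false, j), (k : ℝ)) = f ((true, k), (j : ℝ))

/-- energy in terms of Bochner integrals -/
def En (f d : Om → ℝ) : ℝ :=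
  (1 / 2) * (∫ z, d z ^ 2 ∂nu) - (1 / 4) * (∫ z, f z ^ 4 ∂nu)

namespace Good
variable {f d g e : Om → ℝ}

lemma intf (h : Good f d) : Integrable (fun z => f z ^ 2) nu := h.mf.integrable_sq
lemma intd (h : Good f d) : Integrable (fun z => d z ^ 2) nu := h.md.integrable_sq

lemma ii (h : Good f d) (i : Ln) (a b : ℝ) :
    IntervalIntegrable (fun t => d (i, t)) volume a b := by
  rw [intervalIntegrable_iff]
  exact ((memLp_line h.md i).locallyIntegrable (by norm_num)).integrableOn_isCompact
    isCompact_uIcc |>.mono_set Set.uIoc_subset_uIcc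

lemma ftc' (h : Good f d) (i : Ln) (a b : ℝ) :
    (∫ t in a..b, d (i, t)) = f (i, b) - f (i, a) := by
  have := intervalIntegral.integral_interval_sub_left (h.ii i 0 b) (h.ii i 0 a)
  rw [h.ftc, h.ftc] at this
  linarith

lemma holder (h : Good f d) (i : Ln) {a b : ℝ} (hab : a ≤ b) :
    (f (i, b) - f (i, a)) ^ 2 ≤ (b - a) * ∫ z, d z ^ 2 ∂nu := by
  rw [← h.ftc' i a b]
  have hd2 : Integrable (fun t => d (i, t) ^ 2) := integrable_line h.intd i
  have hii : IntervalIntegrable (fun t => d (i, t) ^ 2) volume a b := hd2.intervalIntegrable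
  have hle : ∫ t in a..b, d (i, t) ^ 2 ≤ ∫ z, d z ^ 2 ∂nu := by
    rw [intervalIntegral.integral_of_le hab]
    exact (setIntegral_le_integral hd2 (ae_of_all _ fun x => sq_nonneg _)).trans
      (integral_line_le h.intd (fun z => sq_nonneg _) i)
  set I := ∫ t in a..b, d (i, t) with hI
  set J := ∫ t in a..b, d (i, t) ^ 2 with hJ
  -- polynomial nonnegative
  rcases hab.eq_or_lt with rfl | hlt
  · simp [hI]
  have key : 0 ≤ ∫ t in a..b, (d (i, t) - I / (b - a)) ^ 2 :=
    intervalIntegral.integral_nonneg hab fun x _ => sq_nonneg _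
  have e1 : ∫ t in a..b, (d (i, t) - I / (b - a)) ^ 2 =
      J - 2 * (I / (b - a)) * I + (b - a) * (I / (b - a)) ^ 2 := by
    have : ∀ t, (d (i, t) - I / (b - a)) ^ 2 =
        (d (i, t) ^ 2 - (2 * (I / (b - a))) * d (i, t)) + (I / (b - a)) ^ 2 := fun t => by ring
    simp only [this]
    rw [intervalIntegral.integral_add (hii.sub ((h.ii i a b).const_mul _)) (by simp),
      intervalIntegral.integral_sub hii ((h.ii i a b).const_mul _),
      intervalIntegral.integral_const_mul, intervalIntegral.integral_const]
    simp [hI, hJ]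
  rw [e1] at key
  have hpos : 0 < b - a := by linarith
  have e2 : (b - a) * (J - 2 * (I / (b - a)) * I + (b - a) * (I / (b - a)) ^ 2)
      = (b - a) * J - I ^ 2 := by
    field_simp; ring
  have := mul_nonneg hpos.le key
  rw [e2] at this
  nlinarith

lemma holder' (h : Good f d) (i : Ln) (a b : ℝ) :
    (f (i, b) - f (i, a)) ^ 2 ≤ |b - a| * ∫ z, d z ^ 2 ∂nu := by
  rcases le_total a b with hab | hab
  · rw [abs_of_nonneg (by linarith)]; exact h.holder i hab
  · rw [abs_of_nonpos (by linarith), ← neg_sq, neg_sub, neg_sub]; exact h.holder i hab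

lemma sup_bound (h : Good f d) (z : Om) {l : ℝ} (hl : 0 < l) :
    f z ^ 2 ≤ 2 / l * (∫ z, f z ^ 2 ∂nu) + 2 * l * ∫ z, d z ^ 2 ∂nu := by
  obtain ⟨i, x⟩ := z
  set T := ∫ z, d z ^ 2 ∂nu
  have hT : 0 ≤ T := integral_nonneg fun z => sq_nonneg _
  have hf2 : Integrable (fun t => f (i, t) ^ 2) := integrable_line h.intf i
  have h1 : ∀ y ∈ Set.Icc x (x + l), f (i, x) ^ 2 ≤ 2 * f (i, y) ^ 2 + 2 * (l * T) := by
    intro y hy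
    have := h.holder i hy.1
    have h2 : (y - x) * T ≤ l * T := by
      apply mul_le_mul_of_nonneg_right _ hT; linarith [hy.2]
    nlinarith [sq_nonneg (f (i, x) - 2 * f (i, y))]
  have h2 := intervalIntegral.integral_mono_on (μ := volume) (a := x) (b := x + l) (by linarith)
    (f := fun _ => f (i, x) ^ 2) (g := fun y => 2 * f (i, y) ^ 2 + 2 * (l * T))
    (by simp) ((hf2.intervalIntegrable.const_mul 2).add (by simp)) h1
  rw [intervalIntegral.integral_add (hf2.intervalIntegrable.const_mul 2) (by simp),
    intervalIntegral.integral_const_mul, intervalIntegral.integral_const,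
    intervalIntegral.integral_const] at h2
  have hle : ∫ t in x..(x+l), f (i, t) ^ 2 ≤ ∫ z, f z ^ 2 ∂nu := by
    rw [intervalIntegral.integral_of_le (by linarith)]
    exact (setIntegral_le_integral hf2 (ae_of_all _ fun x => sq_nonneg _)).trans
      (integral_line_le h.intf (fun z => sq_nonneg _) i)
  simp only [smul_eq_mul, add_sub_cancel_left] at h2
  rw [div_mul_eq_mul_div, ← sub_le_iff_le_add, le_div_iff₀ hl]
  nlinarith

lemma bdd (h : Good f d) (z : Om) :
    f z ^ 2 ≤ 2 * (∫ z, f z ^ 2 ∂nu) + 2 * ∫ z, d z ^ 2 ∂nu := by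
  simpa using h.sup_bound z one_pos

lemma int4_of_bdd {C : ℝ} (hf : MemLp f 2 nu) (hC : ∀ z, f z ^ 2 ≤ C) :
    Integrable (fun z => f z ^ 4) nu := by
  refine (hf.integrable_sq.const_mul C).mono' (hf.1.pow 4) (ae_of_all _ fun z => ?_)
  rw [Real.norm_of_nonneg (by positivity)]
  nlinarith [sq_nonneg (f z), hC z]

lemma int4 (h : Good f d) : Integrable (fun z => f z ^ 4) nu := int4_of_bdd h.mf h.bdd

lemma int4_le (h : Good f d) {C : ℝ} (hC : ∀ z, f z ^ 2 ≤ C) :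
    ∫ z, f z ^ 4 ∂nu ≤ C * ∫ z, f z ^ 2 ∂nu := by
  rw [← integral_const_mul]
  refine integral_mono h.int4 (h.intf.const_mul C) fun z => ?_
  simp only
  nlinarith [sq_nonneg (f z), hC z]

lemma eq_zero_of_deriv (h : Good f d) (h0 : ∫ z, d z ^ 2 ∂nu ≤ 0) (z : Om) : f z = 0 := by
  by_contra hne
  have hp : 0 < f z ^ 2 := by positivity
  set m := ∫ z, f z ^ 2 ∂nu with hm
  have hm0 : 0 ≤ m := integral_nonneg fun z => sq_nonneg _
  have hl : 0 < 2 * (m + 1) / f z ^ 2 := by positivity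
  have h1 := h.sup_bound z hl
  have h2 : 2 * (2 * (m + 1) / f z ^ 2) * ∫ z, d z ^ 2 ∂nu ≤ 0 :=
    mul_nonpos_of_nonneg_of_nonpos (by positivity) h0
  rw [← hm] at h1
  have h3 : 2 / (2 * (m + 1) / f z ^ 2) * m = f z ^ 2 * (m / (m + 1)) := by field_simp
  rw [h3] at h1
  have h4 : m / (m + 1) < 1 := by rw [div_lt_one (by linarith)]; linarith
  nlinarith

lemma deriv_pos (h : Good f d) (hm : 0 < ∫ z, f z ^ 2 ∂nu) : 0 < ∫ z, d z ^ 2 ∂nu := by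
  by_contra hcon
  have := h.eq_zero_of_deriv (not_lt.1 hcon)
  simp [this] at hm

lemma int_pow_pos (h : Good f d) {z : Om} (hz : f z ≠ 0) {n : ℕ} (hn : Even n)
    (hi : Integrable (fun z => f z ^ n) nu) : 0 < ∫ z, f z ^ n ∂nu := by
  have hnn : ∀ z, 0 ≤ f z ^ n := fun z => hn.pow_nonneg _
  refine lt_of_le_of_ne (integral_nonneg hnn) fun h0 => ?_
  rw [eq_comm, integral_eq_zero_iff_of_nonneg hnn hi] at h0
  obtain ⟨i, x⟩ := z
  have h1 : (fun x => f (i, x)) =ᵐ[volume] fun _ => 0 := by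
    filter_upwards [ae_nu h0 i] with x hx
    by_contra hne
    exact pow_ne_zero n hne hx
  have := (h.cont i).ae_eq_iff_eq volume continuous_const |>.1 h1
  exact hz (congrFun this x)

lemma smul (h : Good f d) (c : ℝ) : Good (fun z => c * f z) (fun z => c * d z) where
  cont i := continuous_const.mul (h.cont i)
  mf := h.mf.const_mul c
  md := h.md.const_mul c
  ftc i x := by rw [intervalIntegral.integral_const_mul, h.ftc]; ring
  compat j k := by simp [h.compat]

lemma sub (h : Good f d) (h' : Good g e) : Good (fun z => f z - g z) (fun z => d z - e z) where
  cont i := (h.cont i).sub (h'.cont i)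
  mf := h.mf.sub h'.mf
  md := h.md.sub h'.md
  ftc i x := by
    rw [intervalIntegral.integral_sub (h.ii i 0 x) (h'.ii i 0 x), h.ftc, h'.ftc]; ring
  compat j k := by simp [h.compat, h'.compat]

lemma En_smul (f d : Om → ℝ) (c : ℝ) : En (fun z => c * f z) (fun z => c * d z) =
    (1 / 2) * (c ^ 2 * ∫ z, d z ^ 2 ∂nu) - (1 / 4) * (c ^ 4 * ∫ z, f z ^ 4 ∂nu) := by
  simp only [En, mul_pow, integral_const_mul]

/-- coercivity -/
lemma coercive (h : Good f d) {μ : ℝ} (hμ : 0 < μ) (hm : ∫ z, f z ^ 2 ∂nu = μ) :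
    (1 / 4) * (∫ z, d z ^ 2 ∂nu) - μ ^ 3 ≤ En f d := by
  have h1 := h.int4_le (fun z => h.sup_bound z (l := 1 / (2 * μ)) (by positivity))
  rw [hm] at h1
  unfold En
  have h2 : (2 / (1 / (2 * μ)) * μ + 2 * (1 / (2 * μ)) * ∫ z, d z ^ 2 ∂nu) * μ =
    4 * μ ^ 3 + ∫ z, d z ^ 2 ∂nu := by field_simp; ring
  rw [h2] at h1
  linarith

end Good

lemma mp_shift (σ : Ln ≃ Ln) (s : Ln → ℝ) :
    MeasurePreserving (fun z : Om => ((σ z.1, z.2 + s z.1) : Om)) nu nu := by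
  have hmeas : Measurable (fun z : Om => ((σ z.1, z.2 + s z.1) : Om)) := by
    refine Measurable.prodMk ?_ ?_
    · exact (measurable_of_countable σ).comp measurable_fst
    · exact measurable_snd.add ((measurable_of_countable s).comp measurable_fst)
  refine ⟨hmeas, ?_⟩
  ext A hA
  rw [Measure.map_apply hmeas hA, nu_apply (hmeas hA), nu_apply hA,
    ← Equiv.tsum_eq σ (fun i => volume (Prod.mk i ⁻¹' A))]
  congr 1; ext i
  exact measure_preimage_add_right volume (s i) (Prod.mk (σ i) ⁻¹' A)

lemma Good.shift {f d : Om → ℝ} (h : Good f d) (σ : Ln ≃ Ln) (s : Ln → ℝ)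
    (hc : ∀ j k : ℤ, f (σ (false, j), (k : ℝ) + s (false, j)) =
      f (σ (true, k), (j : ℝ) + s (true, k))) :
    Good (fun z => f (σ z.1, z.2 + s z.1)) (fun z => d (σ z.1, z.2 + s z.1)) where
  cont i := (h.cont (σ i)).comp (continuous_id.add (continuous_const (y := s i)))
  mf := h.mf.comp_measurePreserving (mp_shift σ s)
  md := h.md.comp_measurePreserving (mp_shift σ s)
  ftc i x := by
    simp only
    rw [intervalIntegral.integral_comp_add_right (fun t => d (σ i, t)), h.ftc']
  compat := hc

lemma integral_shift (σ : Ln ≃ Ln) (s : Ln → ℝ) {g : Om → ℝ} (hg : AEStronglyMeasurable g nu) :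
    ∫ z : Om, g (σ z.1, z.2 + s z.1) ∂nu = ∫ z, g z ∂nu := by
  have hp := mp_shift σ s
  conv_rhs => rw [← hp.map_eq]
  rw [integral_map hp.measurable.aemeasurable (by rw [hp.map_eq]; exact hg)]

/-- Using the symmetries of the grid, any point may be moved to the edge from `(0,0)` to `(1,0)`. -/
lemma normalize {f d : Om → ℝ} (h : Good f d) (z : Om) :
    ∃ f' d', Good f' d' ∧ (∫ z, f' z ^ 2 ∂nu = ∫ z, f z ^ 2 ∂nu) ∧ En f' d' = En f d ∧
      (∫ z, d' z ^ 2 ∂nu = ∫ z, d z ^ 2 ∂nu) ∧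
      ∃ t ∈ Set.Icc (0:ℝ) 1, f' ((false, 0), t) = f z := by
  have gen : ∀ (σ : Ln ≃ Ln) (s : Ln → ℝ), (∀ j k : ℤ, f (σ (false, j), (k : ℝ) + s (false, j)) =
      f (σ (true, k), (j : ℝ) + s (true, k))) → (σ (false, 0) = z.1) →
      (∃ t ∈ Set.Icc (0:ℝ) 1, t + s (false, 0) = z.2) → 
      ∃ f' d', Good f' d' ∧ (∫ z, f' z ^ 2 ∂nu = ∫ z, f z ^ 2 ∂nu) ∧ En f' d' = En f d ∧
      (∫ z, d' z ^ 2 ∂nu = ∫ z, d z ^ 2 ∂nu) ∧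
      ∃ t ∈ Set.Icc (0:ℝ) 1, f' ((false, 0), t) = f z := by
    rintro σ s hc h1 ⟨t, ht, h2⟩
    have e4 := integral_shift σ s (g := fun z => f z ^ 4) h.int4.1
    have e2 := integral_shift σ s (g := fun z => d z ^ 2) h.intd.1
    have e3 := integral_shift σ s (g := fun z => f z ^ 2) h.intf.1
    refine ⟨fun z => f (σ z.1, z.2 + s z.1), fun z => d (σ z.1, z.2 + s z.1),
      h.shift σ s hc, e3, ?_, e2, t, ht, ?_⟩
    · unfold En
      rw [e4, e2]
    · simp only [h1, h2]
  obtain ⟨⟨b, j⟩, x⟩ := z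
  have hfl : ∃ t ∈ Set.Icc (0:ℝ) 1, t + (⌊x⌋ : ℝ) = x :=
    ⟨x - ⌊x⌋, ⟨by linarith [Int.floor_le x], by linarith [Int.lt_floor_add_one x]⟩, by ring⟩
  cases b with
  | false =>
    refine gen ⟨fun i => (i.1, i.2 + bif i.1 then ⌊x⌋ else j),
      fun i => (i.1, i.2 - bif i.1 then ⌊x⌋ else j), fun i => by simp, fun i => by simp⟩
      (fun i => ((bif i.1 then j else ⌊x⌋ : ℤ) : ℝ)) ?_ (by simp) (by simpa using hfl)
    intro a b
    have := h.compat (a + j) (b + ⌊x⌋)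
    push_cast at this
    simpa using this
  | true =>
    refine gen ⟨fun i => (!i.1, i.2 + bif i.1 then ⌊x⌋ else j),
      fun i => (!i.1, i.2 - bif i.1 then j else ⌊x⌋), fun i => by rcases i with ⟨_ | _, _⟩ <;> simp,
      fun i => by rcases i with ⟨_ | _, _⟩ <;> simp⟩
      (fun i => ((bif i.1 then j else ⌊x⌋ : ℤ) : ℝ)) ?_ (by simp) (by simpa using hfl)
    intro a b
    have := h.compat (b + ⌊x⌋) (a + j)
    push_cast at this
    simpa using this.symm

end GridAux
end

open MeasureTheory Filter Topology
open scoped ENNReal NNReal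
noncomputable section
namespace GridAux

/-- glue the horizontal and vertical restrictions -/
def glue (h w : ℤ → ℝ → ℝ) : Om → ℝ := fun z => bif z.1.1 then w z.1.2 z.2 else h z.1.2 z.2

lemma gridLpPow_eq (p : ℝ) (h w : ℤ → ℝ → ℝ) :
    gridLpPow p h w = ∫⁻ z, (‖glue h w z‖₊ : ℝ≥0∞) ^ p ∂nu := by
  rw [lintegral_nu, ENNReal.tsum_prod', tsum_bool]
  rfl

lemma aesm_glue {h w : ℤ → ℝ → ℝ} (hh : ∀ j, AEStronglyMeasurable (h j) volume)
    (hw : ∀ j, AEStronglyMeasurable (w j) volume) : AEStronglyMeasurable (glue h w) nu := by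
  rw [aesm_nu]
  rintro ⟨_ | _, j⟩
  · exact hh j
  · exact hw j

lemma toReal_two {f : Om → ℝ} (hf : AEStronglyMeasurable f nu) :
    (∫⁻ z, (‖f z‖₊ : ℝ≥0∞) ^ (2:ℝ) ∂nu).toReal = ∫ z, f z ^ 2 ∂nu := by
  rw [integral_eq_lintegral_of_nonneg_ae (ae_of_all _ fun z => sq_nonneg _) (by fun_prop)]
  congr 1
  refine lintegral_congr fun z => ?_
  rw [← sq_abs, ENNReal.ofReal_pow (abs_nonneg _), ← Real.norm_eq_abs, ofReal_norm]
  norm_cast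

lemma toReal_four {f : Om → ℝ} (hf : AEStronglyMeasurable f nu) :
    (∫⁻ z, (‖f z‖₊ : ℝ≥0∞) ^ (4:ℝ) ∂nu).toReal = ∫ z, f z ^ 4 ∂nu := by
  rw [integral_eq_lintegral_of_nonneg_ae (ae_of_all _ fun z => by positivity) (by fun_prop)]
  congr 1
  refine lintegral_congr fun z => ?_
  have : f z ^ 4 = |f z| ^ 4 := by rw [pow_abs, abs_of_nonneg (by positivity)]
  rw [this, ENNReal.ofReal_pow (abs_nonneg _), ← Real.norm_eq_abs, ofReal_norm]
  norm_cast

lemma memLp_two_iff {f : Om → ℝ} (hf : AEStronglyMeasurable f nu) :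
    MemLp f 2 nu ↔ ∫⁻ z, (‖f z‖₊ : ℝ≥0∞) ^ (2:ℝ) ∂nu < ⊤ := by
  have := eLpNorm_lt_top_iff_lintegral_rpow_enorm_lt_top (μ := nu) (f := f) (p := 2)
    (by norm_num) (by norm_num)
  simp only [ENNReal.toReal_ofNat] at this
  exact ⟨fun h => this.1 h.2, fun h => ⟨hf, this.2 h⟩⟩

lemma good_of_memH1 {u : GridFunc} (hu : u.MemH1) : Good (glue u.h u.w) (glue u.hd u.wd) := by
  obtain ⟨h1, h2, h3, h4, h5, h6, h7, h8⟩ := hu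
  have a1 : AEStronglyMeasurable (glue u.h u.w) nu :=
    aesm_glue (fun j => (h1 j).aestronglyMeasurable) fun j => (h2 j).aestronglyMeasurable
  have a2 : AEStronglyMeasurable (glue u.hd u.wd) nu :=
    aesm_glue (fun j => (h3 j).aestronglyMeasurable) fun j => (h4 j).aestronglyMeasurable
  refine ⟨?_, (memLp_two_iff a1).2 (gridLpPow_eq 2 _ _ ▸ h7),
    (memLp_two_iff a2).2 (gridLpPow_eq 2 _ _ ▸ h8), ?_, fun j k => u.compat j k⟩
  · rintro ⟨_ | _, j⟩
    · exact h1 j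
    · exact h2 j
  · rintro ⟨_ | _, j⟩ x
    · exact h5 j x
    · exact h6 j x

lemma mass_eq {u : GridFunc} (hu : u.MemH1) :
    (gridLpPow 2 u.h u.w).toReal = ∫ z, glue u.h u.w z ^ 2 ∂nu := by
  rw [gridLpPow_eq, toReal_two (good_of_memH1 hu).mf.1]

lemma kin_eq {u : GridFunc} (hu : u.MemH1) :
    (gridLpPow 2 u.hd u.wd).toReal = ∫ z, glue u.hd u.wd z ^ 2 ∂nu := by
  rw [gridLpPow_eq, toReal_two (good_of_memH1 hu).md.1]

lemma pot_eq {u : GridFunc} (hu : u.MemH1) :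
    (gridLpPow 4 u.h u.w).toReal = ∫ z, glue u.h u.w z ^ 4 ∂nu := by
  rw [gridLpPow_eq, toReal_four (good_of_memH1 hu).mf.1]

lemma energy_eq {u : GridFunc} (hu : u.MemH1) :
    u.energy 4 = En (glue u.h u.w) (glue u.hd u.wd) := by
  rw [GridFunc.energy, En, kin_eq hu, pot_eq hu]

/-- build a grid function -/
lemma exists_of_good {f d : Om → ℝ} (h : Good f d) :
    ∃ u : GridFunc, u.MemH1 ∧ glue u.h u.w = f ∧ glue u.hd u.wd = d := by
  have g1 : ∀ f : Om → ℝ, glue (fun j x => f ((false, j), x)) (fun j x => f ((true, j), x)) = f := by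
    intro f
    funext ⟨⟨b, j⟩, x⟩
    cases b <;> rfl
  refine ⟨⟨fun j x => f ((false, j), x), fun j x => f ((true, j), x),
    fun j x => d ((false, j), x), fun j x => d ((true, j), x), h.compat⟩, ?_, g1 f, g1 d⟩
  refine ⟨fun j => h.cont _, fun j => h.cont _,
    fun j => (memLp_line h.md _).locallyIntegrable (by norm_num),
    fun j => (memLp_line h.md _).locallyIntegrable (by norm_num),
    fun j x => h.ftc _ x, fun j x => h.ftc _ x, ?_, ?_⟩
  · rw [gridLpPow_eq, ← memLp_two_iff] <;> simp only [g1]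
    · exact h.mf
    · exact h.mf.1
  · rw [gridLpPow_eq, ← memLp_two_iff] <;> simp only [g1]
    · exact h.md
    · exact h.md.1

lemma integrable_exp_abs {b : ℝ} (hb : 0 < b) : Integrable fun x : ℝ => Real.exp (-b * |x|) := by
  rw [← integrableOn_univ, ← Set.Iic_union_Ioi (a := (0:ℝ))]
  refine IntegrableOn.union ?_ ?_
  · refine (integrableOn_exp_mul_Iic hb 0).congr_fun (fun x hx => ?_) measurableSet_Iic
    simp only
    rw [abs_of_nonpos hx]; ring_nf
  · refine (exp_neg_integrableOn_Ioi 0 hb).congr_fun (fun x hx => ?_) measurableSet_Ioi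
    simp only
    rw [abs_of_pos hx]

lemma summable_exp_abs {b : ℝ} (hb : 0 < b) :
    Summable fun j : ℤ => Real.exp (-b * |(j : ℝ)|) := by
  have h1 : Summable fun n : ℕ => Real.exp (-b * n) := by
    have := (Real.summable_exp_nat_mul_iff (a := -b)).2 (by linarith)
    refine this.congr fun n => ?_
    rw [mul_comm]
  exact Summable.of_nat_of_neg (by simpa using h1) (by simpa using h1)

/-- the exponential test function -/
def tf (ε : ℝ) : Om → ℝ := fun z => Real.exp (-ε * (|z.2| + |(z.1.2 : ℝ)|))
/-- its derivative -/
def td (ε : ℝ) : Om → ℝ := fun z => (if z.2 < 0 then ε else -ε) * tf ε z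

lemma td_sq (ε : ℝ) (z : Om) : td ε z ^ 2 = ε ^ 2 * tf ε z ^ 2 := by
  unfold td; split_ifs <;> ring

lemma good_test {ε : ℝ} (hε : 0 < ε) : Good (tf ε) (td ε) := by
  have hc : ∀ i, Continuous fun x => tf ε (i, x) := by
    intro i; unfold tf; fun_prop
  have am : AEStronglyMeasurable (tf ε) nu := aesm_nu.2 fun i => (hc i).aestronglyMeasurable
  have am' : AEStronglyMeasurable (td ε) nu := by
    refine aesm_nu.2 fun i => ?_
    unfold td
    refine Measurable.aestronglyMeasurable ?_
    exact (Measurable.ite measurableSet_Iio measurable_const measurable_const).mul (hc i).measurable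
  have hm : MemLp (tf ε) 2 nu := by
    rw [memLp_two_iff am, lintegral_nu]
    have e : ∀ i : Ln, ∫⁻ x, (‖tf ε (i, x)‖₊ : ℝ≥0∞) ^ (2:ℝ) =
        ENNReal.ofReal (Real.exp (-(2 * ε) * |(i.2 : ℝ)|)) *
        ∫⁻ x : ℝ, ENNReal.ofReal (Real.exp (-(2 * ε) * |x|)) := by
      intro i
      rw [← lintegral_const_mul _ (by fun_prop)]
      refine lintegral_congr fun x => ?_
      rw [← ENNReal.ofReal_mul (Real.exp_pos _).le, ← Real.exp_add]
      have : (‖tf ε (i, x)‖₊ : ℝ≥0∞) = ENNReal.ofReal (tf ε (i, x)) :=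
        (Real.enorm_of_nonneg (Real.exp_pos _).le)
      rw [this, ENNReal.ofReal_rpow_of_pos (show 0 < tf ε (i, x) from Real.exp_pos _)]
      congr 1
      rw [tf, ← Real.exp_mul]
      congr 1; ring
    simp only [e]
    rw [ENNReal.tsum_mul_right]
    refine ENNReal.mul_lt_top ?_ ?_
    · rw [ENNReal.tsum_prod', tsum_bool]
      have := (summable_exp_abs (b := 2 * ε) (by positivity)).tsum_ofReal_lt_top
      exact ENNReal.add_lt_top.2 ⟨this, this⟩
    · have := (integrable_exp_abs (b := 2 * ε) (by positivity)).lintegral_lt_top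
      exact this
  have hm' : MemLp (td ε) 2 nu := by
    rw [memLp_two_iff_integrable_sq am']
    simp only [td_sq]
    exact hm.integrable_sq.const_mul _
  refine ⟨hc, hm, hm', ?_, ?_⟩
  · intro i x
    refine integral_eq_of_hasDerivAt_off_countable (fun x => tf ε (i, x)) (fun x => td ε (i, x))
      (Set.countable_singleton 0) (hc i).continuousOn ?_ ?_
    · rintro y ⟨-, hy⟩
      have hy0 : y ≠ 0 := hy
      unfold td tf
      simp only
      have h1 : HasDerivAt (fun x : ℝ => |x|) (if y < 0 then -1 else 1) y := by
        split_ifs with h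
        · exact hasDerivAt_abs_neg h
        · exact hasDerivAt_abs_pos (lt_of_le_of_ne (not_lt.1 h) (Ne.symm hy0))
      have h2 := ((h1.add_const |(i.2:ℝ)|).const_mul (-ε)).exp
      refine h2.congr_deriv ?_
      split_ifs <;> ring
    · rw [intervalIntegrable_iff]
      exact ((memLp_line hm' i).locallyIntegrable (by norm_num)).integrableOn_isCompact
        isCompact_uIcc |>.mono_set Set.uIoc_subset_uIcc
  · intro j k
    simp [tf, add_comm]

lemma test_mass_pos {ε : ℝ} (hε : 0 < ε) : 0 < ∫ z, tf ε z ^ 2 ∂nu :=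
  (good_test hε).int_pow_pos (z := ((false, 0), 0)) (Real.exp_pos _).ne' (by decide)
    (good_test hε).intf

lemma test_kin (ε : ℝ) : ∫ z, td ε z ^ 2 ∂nu = ε ^ 2 * ∫ z, tf ε z ^ 2 ∂nu := by
  simp only [td_sq, integral_const_mul]

/-- functions of mass `μ` with arbitrarily small energy -/
lemma small_energy {μ η : ℝ} (hμ : 0 < μ) (hη : 0 < η) :
    ∃ f d, Good f d ∧ ∫ z, f z ^ 2 ∂nu = μ ∧ En f d < η := by
  set ε := Real.sqrt (η / μ)
  have hε : 0 < ε := Real.sqrt_pos.2 (by positivity)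
  have hε2 : ε ^ 2 = η / μ := Real.sq_sqrt (by positivity)
  have hm := test_mass_pos hε
  set m := ∫ z, tf ε z ^ 2 ∂nu with hmdef
  have hc2 : Real.sqrt (μ / m) ^ 2 = μ / m := Real.sq_sqrt (by positivity)
  refine ⟨_, _, (good_test hε).smul (Real.sqrt (μ / m)), ?_, ?_⟩
  · simp only [mul_pow, integral_const_mul]
    rw [hc2, ← hmdef]; field_simp
  · rw [Good.En_smul, hc2, test_kin, hε2, ← hmdef]
    have h4 : 0 ≤ ∫ z, tf ε z ^ 4 ∂nu := integral_nonneg fun z => by positivity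
    have : μ / m * (η / μ * m) = η := by field_simp
    rw [this]
    have : 0 ≤ Real.sqrt (μ / m) ^ 4 * ∫ z, tf ε z ^ 4 ∂nu := by positivity
    linarith

end GridAux
end

open MeasureTheory Filter Topology
open scoped ENNReal NNReal
noncomputable section
namespace GridAux

lemma scaled {f d : Om → ℝ} {μ I : ℝ} (hμ : 0 < μ)
    (hI : ∀ f d, Good f d → ∫ z, f z ^ 2 ∂nu = μ → I ≤ En f d) (h : Good f d)
    (hm : 0 < ∫ z, f z ^ 2 ∂nu) :
    (∫ z, f z ^ 2 ∂nu) / μ * I ≤ (1 / 2) * (∫ z, d z ^ 2 ∂nu) -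
      (1 / 4) * (μ / (∫ z, f z ^ 2 ∂nu)) * (∫ z, f z ^ 4 ∂nu) := by
  set m := ∫ z, f z ^ 2 ∂nu with hmdef
  have hc2 : Real.sqrt (μ / m) ^ 2 = μ / m := Real.sq_sqrt (by positivity)
  have hc4 : Real.sqrt (μ / m) ^ 4 = (μ / m) ^ 2 := by
    rw [show Real.sqrt (μ / m) ^ 4 = (Real.sqrt (μ / m) ^ 2) ^ 2 by ring, hc2]
  have h1 := hI _ _ (h.smul (Real.sqrt (μ / m))) (by
    simp only [mul_pow, integral_const_mul]
    rw [hc2, ← hmdef]; field_simp)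
  rw [Good.En_smul, hc2, hc4] at h1
  have h2 := mul_le_mul_of_nonneg_left h1 (show 0 ≤ m / μ by positivity)
  refine h2.trans (le_of_eq ?_)
  field_simp

lemma low {f d : Om → ℝ} {μ I : ℝ} (hμ : 0 < μ)
    (hI : ∀ f d, Good f d → ∫ z, f z ^ 2 ∂nu = μ → I ≤ En f d) (h : Good f d)
    (hm : ∫ z, f z ^ 2 ∂nu ≤ μ) : (∫ z, f z ^ 2 ∂nu) / μ * I ≤ En f d := by
  have hT : 0 ≤ ∫ z, d z ^ 2 ∂nu := integral_nonneg fun z => sq_nonneg _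
  have hF : 0 ≤ ∫ z, f z ^ 4 ∂nu := integral_nonneg fun z => by positivity
  rcases (integral_nonneg (μ := nu) (f := fun z => f z ^ 2) fun z => sq_nonneg _).eq_or_lt
    with h0 | h0
  · have hz : ∀ z, f z = 0 := by
      intro z
      by_contra hne
      have := h.int_pow_pos hne (n := 2) (by decide) h.intf
      linarith
    simp only [En, hz]
    simp only [ne_eq, OfNat.ofNat_ne_zero, not_false_eq_true, zero_pow, integral_zero, zero_div,
      zero_mul]
    linarith
  · have h1 := scaled hμ hI h h0
    have h2 : 1 ≤ μ / (∫ z, f z ^ 2 ∂nu) := by rwa [one_le_div h0]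
    unfold En
    nlinarith

lemma cross {u : Om → ℝ} {r : ℕ → Om → ℝ} {C : ℝ} (hu : MemLp u 2 nu)
    (hr : ∀ n, MemLp (r n) 2 nu) (hC : ∀ n, ∫ z, r n z ^ 2 ∂nu ≤ C)
    (h0 : ∀ z, Tendsto (fun n => r n z) atTop (𝓝 0)) :
    Tendsto (fun n => ∫ z, |u z * r n z| ∂nu) atTop (𝓝 0) := by
  have hC0 : 0 ≤ C := (integral_nonneg fun z => sq_nonneg _).trans (hC 0)
  have hint : ∀ n, Integrable (fun z => |u z * r n z|) nu := fun n =>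
    (hu.integrable_mul (hr n)).abs
  rw [tendsto_order]
  refine ⟨fun a ha => Eventually.of_forall fun n =>
    lt_of_lt_of_le ha (integral_nonneg fun z => abs_nonneg _), fun δ hδ => ?_⟩
  set ε := δ / (2 * (C + 1)) with hε
  have hεp : 0 < ε := by positivity
  let W : ℕ → Om → ℝ := fun n z => max (|u z * r n z| - ε * r n z ^ 2) 0
  have hWm : ∀ n, AEStronglyMeasurable (W n) nu := fun n => by
    have h1 := ((hint n).1.sub ((hr n).integrable_sq.const_mul ε).1)
    exact h1.sup aestronglyMeasurable_const
  have hWle : ∀ n z, ‖W n z‖ ≤ 1 / (4 * ε) * u z ^ 2 := by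
    intro n z
    rw [Real.norm_of_nonneg (le_max_right _ _)]
    refine max_le ?_ (by positivity)
    rw [abs_mul, ← sq_abs (r n z), ← sq_abs (u z), show 1 / (4 * ε) * |u z| ^ 2 = |u z| ^ 2 / (4 * ε) by ring,
      le_div_iff₀ (by positivity)]
    nlinarith [sq_nonneg (|u z| - 2 * ε * |r n z|)]
  have hWi : ∀ n, Integrable (W n) nu := fun n =>
    (hu.integrable_sq.const_mul _).mono' (hWm n) (ae_of_all _ (hWle n))
  have hlim : Tendsto (fun n => ∫ z, W n z ∂nu) atTop (𝓝 (∫ z : Om, (0:ℝ) ∂nu)) := by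
    refine tendsto_integral_of_dominated_convergence (fun z => 1 / (4 * ε) * u z ^ 2) hWm
      (hu.integrable_sq.const_mul _) (fun n => ae_of_all _ (hWle n)) (ae_of_all _ fun z => ?_)
    have h1 : Tendsto (fun n => |u z * r n z| - ε * r n z ^ 2) atTop
        (𝓝 (|u z * 0| - ε * 0 ^ 2)) :=
      ((h0 z).const_mul (u z)).abs.sub (((h0 z).pow 2).const_mul ε)
    have h2 := h1.max (tendsto_const_nhds (x := (0:ℝ)))
    simpa [W] using h2
  simp only [integral_zero] at hlim
  filter_upwards [hlim.eventually (gt_mem_nhds (half_pos hδ))] with n hn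
  have h1 : ∫ z, |u z * r n z| ∂nu ≤ ∫ z, (ε * r n z ^ 2 + W n z) ∂nu := by
    refine integral_mono (hint n) (((hr n).integrable_sq.const_mul ε).add (hWi n)) fun z => ?_
    have := le_max_left (|u z * r n z| - ε * r n z ^ 2) 0
    simp only [W]
    linarith
  rw [integral_add ((hr n).integrable_sq.const_mul ε) (hWi n), integral_const_mul] at h1
  have h2 : ε * ∫ z, r n z ^ 2 ∂nu ≤ ε * C := mul_le_mul_of_nonneg_left (hC n) hεp.le
  have h3 : ε * C ≤ δ / 2 := by
    rw [hε, div_mul_eq_mul_div, div_le_div_iff₀ (by positivity) (by norm_num)]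
    nlinarith
  linarith

lemma extract {f d : ℕ → Om → ℝ} (hg : ∀ n, Good (f n) (d n)) {μ C c : ℝ} (hμ : 0 < μ)
    (hm : ∀ n, ∫ z, f n z ^ 2 ∂nu = μ) (hC : ∀ n, ∫ z, d n z ^ 2 ∂nu ≤ C) {t : ℕ → ℝ}
    (ht : ∀ n, t n ∈ Set.Icc (0:ℝ) 1) (hc0 : 0 < c) (hc : ∀ n, c ≤ f n ((false, 0), t n) ^ 2) :
    ∃ (φ : ℕ → ℕ) (F D : Om → ℝ), StrictMono φ ∧ Good F D ∧
      (∀ z, Tendsto (fun n => f (φ n) z) atTop (𝓝 (F z))) ∧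
      Tendsto (fun n => ∫ z, d (φ n) z * D z ∂nu) atTop (𝓝 (∫ z, D z * D z ∂nu)) ∧
      (∃ z, F z ≠ 0) ∧ ∫ z, F z ^ 2 ∂nu ≤ μ := by
  obtain ⟨φ₁, D, hφ₁, hD, hweak⟩ := weak_compact d C (fun n => (hg n).md) hC
  have hbd : ∀ n z, f n z ^ 2 ≤ 2 * μ + 2 * C := fun n z => by
    have := (hg n).bdd z
    rw [hm n] at this
    linarith [hC n]
  set M := Real.sqrt (2 * μ + 2 * C)
  have hcpt : IsCompact ((Set.pi Set.univ fun _ : Ln => Set.Icc (-M) M) ×ˢ Set.Icc (0:ℝ) 1) :=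
    (isCompact_univ_pi fun _ => isCompact_Icc).prod isCompact_Icc
  obtain ⟨⟨a, t₀⟩, -, φ₂, hφ₂, hlim⟩ := hcpt.tendsto_subseq
    (x := fun n => (fun i : Ln => f (φ₁ n) (i, 0), t (φ₁ n))) (fun n => by
      refine ⟨fun i _ => ?_, ht _⟩
      exact abs_le.1 (Real.abs_le_sqrt (hbd _ _)))
  rw [nhds_prod_eq, tendsto_prod_iff'] at hlim
  obtain ⟨hl1, hl2⟩ := hlim
  rw [tendsto_pi_nhds] at hl1
  simp only [Function.comp] at hl1 hl2
  have hφ : StrictMono (φ₁ ∘ φ₂) := hφ₁.comp hφ₂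
  let F : Om → ℝ := fun z => a z.1 + ∫ s in (0:ℝ)..z.2, D (z.1, s)
  have hDi : ∀ (i : Ln) (a b : ℝ), IntervalIntegrable (fun s => D (i, s)) volume a b := by
    intro i a b
    rw [intervalIntegrable_iff]
    exact ((memLp_line hD i).locallyIntegrable (by norm_num)).integrableOn_isCompact
      isCompact_uIcc |>.mono_set Set.uIoc_subset_uIcc
  have hset : ∀ (i : Ln) (x y : ℝ), Tendsto (fun n => ∫ s in Set.Ioc x y, d (φ₁ (φ₂ n)) (i, s))
      atTop (𝓝 (∫ s in Set.Ioc x y, D (i, s))) := by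
    intro i x y
    have hms : MeasurableSet ({i} ×ˢ Set.Ioc x y : Set Om) :=
      (measurableSet_singleton i).prod measurableSet_Ioc
    have h1 : MemLp (({i} ×ˢ Set.Ioc x y : Set Om).indicator fun _ => (1:ℝ)) 2 nu :=
      memLp_indicator_const 2 hms 1 (Or.inr (by
        rw [nu_slab i _ measurableSet_Ioc]; simp))
    have h2 := (hweak _ h1).comp hφ₂.tendsto_atTop
    have e : ∀ g : Om → ℝ, ∫ z, g z * (({i} ×ˢ Set.Ioc x y : Set Om).indicator
        (fun _ => (1:ℝ)) z) ∂nu = ∫ s in Set.Ioc x y, g (i, s) := by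
      intro g
      rw [← integral_slab i _ measurableSet_Ioc, ← integral_indicator hms]
      congr 1; ext z
      by_cases hz : z ∈ ({i} ×ˢ Set.Ioc x y : Set Om)
      · rw [Set.indicator_of_mem hz, Set.indicator_of_mem hz, mul_one]
      · rw [Set.indicator_of_notMem hz, Set.indicator_of_notMem hz, mul_zero]
    simp only [e] at h2
    exact h2
  have hptw : ∀ z, Tendsto (fun n => f (φ₁ (φ₂ n)) z) atTop (𝓝 (F z)) := by
    rintro ⟨i, x⟩
    have h1 := (hl1 i).add ((hset i 0 x).sub (hset i x 0))
    refine h1.congr fun n => ?_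
    have := (hg (φ₁ (φ₂ n))).ftc i x
    rw [intervalIntegral] at this
    rw [this]; ring
  have hFc : ∀ i, Continuous fun x => F (i, x) := fun i =>
    (continuous_const (y := a i)).add (intervalIntegral.continuous_primitive (hDi i) 0)
  have hFm : AEStronglyMeasurable F nu := aesm_nu.2 fun i => (hFc i).aestronglyMeasurable
  -- Fatou
  have hfat : ∫⁻ z, ENNReal.ofReal (F z ^ 2) ∂nu ≤ ENNReal.ofReal μ := by
    have h1 : ∀ z, ENNReal.ofReal (F z ^ 2) =
        liminf (fun n => ENNReal.ofReal (f (φ₁ (φ₂ n)) z ^ 2)) atTop := fun z =>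
      (((ENNReal.continuous_ofReal.tendsto _).comp ((hptw z).pow 2)).liminf_eq).symm
    simp only [h1]
    refine (lintegral_liminf_le' fun n => (hg _).intf.1.aemeasurable.ennreal_ofReal).trans ?_
    have h2 : ∀ n, ∫⁻ z, ENNReal.ofReal (f (φ₁ (φ₂ n)) z ^ 2) ∂nu = ENNReal.ofReal μ := by
      intro n
      rw [← ofReal_integral_eq_lintegral_ofReal (hg _).intf (ae_of_all _ fun z => sq_nonneg _), hm]
    simp only [h2]
    simp
  have hF2i : Integrable (fun z => F z ^ 2) nu := by
    refine ⟨hFm.pow 2, ?_⟩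
    rw [hasFiniteIntegral_iff_ofReal (ae_of_all _ fun z => sq_nonneg _)]
    exact hfat.trans_lt ENNReal.ofReal_lt_top
  have hFmem : MemLp F 2 nu := (memLp_two_iff_integrable_sq hFm).2 hF2i
  have hFle : ∫ z, F z ^ 2 ∂nu ≤ μ := by
    rw [integral_eq_lintegral_of_nonneg_ae (ae_of_all _ fun z => sq_nonneg _) hF2i.1]
    exact ENNReal.toReal_le_of_le_ofReal hμ.le hfat
  refine ⟨φ₁ ∘ φ₂, F, D, hφ, ⟨hFc, hFmem, hD, ?_, ?_⟩, hptw,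
    (hweak D hD).comp hφ₂.tendsto_atTop, ⟨((false, 0), t₀), ?_⟩, hFle⟩
  · intro i x
    simp [F]
  · intro j k
    refine tendsto_nhds_unique (hptw _) ?_
    refine (hptw ((true, k), (j:ℝ))).congr fun n => ?_
    rw [(hg _).compat]
  · have h1 : Tendsto (fun n => (f (φ₁ (φ₂ n)) ((false, 0), t (φ₁ (φ₂ n))) -
        f (φ₁ (φ₂ n)) ((false, 0), t₀)) ^ 2) atTop (𝓝 0) := by
      have h2 : Tendsto (fun n => |t (φ₁ (φ₂ n)) - t₀| * C) atTop (𝓝 0) := by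
        have := ((hl2.sub_const t₀).abs).mul_const C
        simpa using this
      refine squeeze_zero (fun n => sq_nonneg _) (fun n => ?_) h2
      exact ((hg _).holder' _ _ _).trans (mul_le_mul_of_nonneg_left (hC _) (abs_nonneg _))
    have h2 : Tendsto (fun n => 2 * (f (φ₁ (φ₂ n)) ((false, 0), t (φ₁ (φ₂ n))) -
        f (φ₁ (φ₂ n)) ((false, 0), t₀)) ^ 2 + 2 * f (φ₁ (φ₂ n)) ((false, 0), t₀) ^ 2) atTop
        (𝓝 (2 * 0 + 2 * F ((false, 0), t₀) ^ 2)) :=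
      (h1.const_mul 2).add (((hptw _).pow 2).const_mul 2)
    have h3 : c ≤ 2 * 0 + 2 * F ((false, 0), t₀) ^ 2 := by
      refine ge_of_tendsto' h2 fun n => (hc (φ₁ (φ₂ n))).trans ?_
      set p := f (φ₁ (φ₂ n)) ((false, 0), t (φ₁ (φ₂ n)))
      set q := f (φ₁ (φ₂ n)) ((false, 0), t₀)
      nlinarith [sq_nonneg (p - 2 * q)]
    intro h0
    rw [h0] at h3
    norm_num at h3
    linarith

end GridAux
end

open MeasureTheory Filter Topology
open scoped ENNReal NNReal
noncomputable section
namespace GridAux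

lemma exists_min {μ : ℝ} (hμ : 0 < μ)
    (hneg : ∃ f d, Good f d ∧ ∫ z, f z ^ 2 ∂nu = μ ∧ En f d < 0) :
    ∃ f d, Good f d ∧ ∫ z, f z ^ 2 ∂nu = μ ∧
      ∀ g e, Good g e → ∫ z, g z ^ 2 ∂nu = μ → En f d ≤ En g e := by
  let S : Set ℝ := {e | ∃ f d, Good f d ∧ ∫ z, f z ^ 2 ∂nu = μ ∧ En f d = e}
  have hbdd : BddBelow S := by
    refine ⟨-μ ^ 3, ?_⟩
    rintro _ ⟨f, d, h, hm, rfl⟩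
    have h1 := h.coercive hμ hm
    have h2 : 0 ≤ ∫ z, d z ^ 2 ∂nu := integral_nonneg fun z => sq_nonneg _
    linarith
  obtain ⟨f₀, d₀, h₀, hm₀, hE₀⟩ := hneg
  have hS0 : En f₀ d₀ ∈ S := ⟨f₀, d₀, h₀, hm₀, rfl⟩
  set I := sInf S with hIdef
  have hI : ∀ f d, Good f d → ∫ z, f z ^ 2 ∂nu = μ → I ≤ En f d := fun f d h hm =>
    csInf_le hbdd ⟨f, d, h, hm, rfl⟩
  have hIneg : I < 0 := (hI _ _ h₀ hm₀).trans_lt hE₀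
  -- normalized minimizing sequence
  have hseq : ∀ n : ℕ, ∃ (f d : Om → ℝ) (t : ℝ), Good f d ∧ ∫ z, f z ^ 2 ∂nu = μ ∧
      En f d < I + 1 / ((n:ℝ) + 1) ∧ ∫ z, d z ^ 2 ∂nu ≤ 4 * μ ^ 3 ∧ t ∈ Set.Icc (0:ℝ) 1 ∧
      -I / μ ≤ f ((false, 0), t) ^ 2 := by
    intro n
    have hlt : I < min (I / 2) (I + 1 / ((n:ℝ) + 1)) := by
      refine lt_min (by linarith) ?_
      have : 0 < 1 / ((n:ℝ) + 1) := by positivity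
      linarith
    obtain ⟨_, ⟨f, d, h, hm, rfl⟩, hE⟩ := exists_lt_of_csInf_lt ⟨_, hS0⟩ hlt
    have hE1 := hE.trans_le (min_le_left _ _)
    have hE2 := hE.trans_le (min_le_right _ _)
    have hT : 0 ≤ ∫ z, d z ^ 2 ∂nu := integral_nonneg fun z => sq_nonneg _
    have hz : ∃ z, -I / μ ≤ f z ^ 2 := by
      by_contra hcon
      push Not at hcon
      have h4 := h.int4_le fun z => (hcon z).le
      rw [hm, div_mul_cancel₀ _ hμ.ne'] at h4
      unfold En at hE1
      linarith
    obtain ⟨z, hz⟩ := hz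
    obtain ⟨f', d', h', hm', hE', hT', t, ht, hft⟩ := normalize h z
    refine ⟨f', d', t, h', hm'.trans hm, hE' ▸ hE2, ?_, ht, hft ▸ hz⟩
    have := h.coercive hμ hm
    rw [hT']
    linarith
  choose f d t hg hm hEn hT ht hft using hseq
  have hElim : Tendsto (fun n => En (f n) (d n)) atTop (𝓝 I) := by
    refine tendsto_of_tendsto_of_tendsto_of_le_of_le tendsto_const_nhds ?_
      (fun n => hI _ _ (hg n) (hm n)) (fun n => (hEn n).le)
    simpa using (tendsto_one_div_add_atTop_nhds_zero_nat (𝕜 := ℝ)).const_add I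
  obtain ⟨φ, F, D, hφ, hF, hptw, hweak, ⟨z₀, hz₀⟩, hFle⟩ :=
    extract hg hμ hm hT ht (div_pos (neg_pos.2 hIneg) hμ) hft
  have hElim' := hElim.comp hφ.tendsto_atTop
  simp only [Function.comp_def] at hElim'
  set m := ∫ z, F z ^ 2 ∂nu with hmdef
  have hmpos : 0 < m := hF.int_pow_pos hz₀ (by decide) hF.intf
  have hQpos : 0 < ∫ z, F z ^ 4 ∂nu := hF.int_pow_pos hz₀ (by decide) hF.int4
  let r : ℕ → Om → ℝ := fun n z => f (φ n) z - F z
  let e : ℕ → Om → ℝ := fun n z => d (φ n) z - D z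
  have hr : ∀ n, Good (r n) (e n) := fun n => (hg (φ n)).sub hF
  have hr0 : ∀ z, Tendsto (fun n => r n z) atTop (𝓝 0) := fun z => by
    simpa using (hptw z).sub_const (F z)
  have hrC : ∀ n, ∫ z, r n z ^ 2 ∂nu ≤ 4 * μ := by
    intro n
    have h1 : ∫ z, r n z ^ 2 ∂nu ≤ ∫ z, (2 * f (φ n) z ^ 2 + 2 * F z ^ 2) ∂nu := by
      refine integral_mono (hr n).intf (((hg _).intf.const_mul 2).add (hF.intf.const_mul 2))
        fun z => ?_
      simp only [r]
      nlinarith [sq_nonneg (f (φ n) z + F z)]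
    rw [integral_add ((hg _).intf.const_mul 2) (hF.intf.const_mul 2), integral_const_mul,
      integral_const_mul, hm, ← hmdef] at h1
    linarith
  have hcross := cross hF.mf (fun n => (hr n).mf) hrC hr0
  have hFr : ∀ n, Integrable (fun z => F z * r n z) nu := fun n => hF.mf.integrable_mul (hr n).mf
  -- masses
  have hmass : Tendsto (fun n => ∫ z, r n z ^ 2 ∂nu) atTop (𝓝 (μ - m)) := by
    have h1 : Tendsto (fun n => ∫ z, F z * r n z ∂nu) atTop (𝓝 0) :=
      squeeze_zero_norm (fun n => norm_integral_le_integral_norm _) hcross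
    have h2 := (tendsto_const_nhds (x := μ - m) (f := atTop (α := ℕ))).sub (h1.const_mul 2)
    rw [mul_zero, sub_zero] at h2
    refine h2.congr fun n => ?_
    have h3 : ∫ z, f (φ n) z ^ 2 ∂nu =
        ∫ z, (F z ^ 2 + 2 * (F z * r n z) + r n z ^ 2) ∂nu := by
      congr 1; ext z; simp only [r]; ring
    have hadd : Integrable (fun z => F z ^ 2 + 2 * (F z * r n z)) nu :=
      hF.intf.add ((hFr n).const_mul 2)
    rw [integral_add hadd (hr n).intf,
      integral_add hF.intf ((hFr n).const_mul 2), integral_const_mul, hm, ← hmdef] at h3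
    linarith
  -- kinetic energies
  have hkin : Tendsto (fun n => ∫ z, d (φ n) z ^ 2 ∂nu - ∫ z, e n z ^ 2 ∂nu) atTop
      (𝓝 (∫ z, D z ^ 2 ∂nu)) := by
    have hDD : ∫ z, D z * D z ∂nu = ∫ z, D z ^ 2 ∂nu := by
      congr 1; ext z; ring
    rw [hDD] at hweak
    have h2 := (hweak.const_mul 2).sub_const (∫ z, D z ^ 2 ∂nu)
    rw [show 2 * (∫ z, D z ^ 2 ∂nu) - (∫ z, D z ^ 2 ∂nu) = ∫ z, D z ^ 2 ∂nu by ring] at h2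
    refine h2.congr fun n => ?_
    have hdD : Integrable (fun z => d (φ n) z * D z) nu := (hg _).md.integrable_mul hF.md
    have h3 : ∫ z, e n z ^ 2 ∂nu =
        ∫ z, (d (φ n) z ^ 2 - 2 * (d (φ n) z * D z) + D z ^ 2) ∂nu := by
      congr 1; ext z; simp only [e]; ring
    have hsub : Integrable (fun z => d (φ n) z ^ 2 - 2 * (d (φ n) z * D z)) nu :=
      (hg _).intd.sub (hdD.const_mul 2)
    rw [integral_add hsub hF.intd,
      integral_sub (hg _).intd (hdD.const_mul 2), integral_const_mul] at h3
    linarith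
  -- potential energies
  have hpot : Tendsto (fun n => ∫ z, f (φ n) z ^ 4 ∂nu - ∫ z, r n z ^ 4 ∂nu) atTop
      (𝓝 (∫ z, F z ^ 4 ∂nu)) := by
    set M := 2 * μ + 2 * (4 * μ ^ 3) with hM
    have hfM : ∀ n z, f n z ^ 2 ≤ M := fun n z => by
      have := (hg n).bdd z
      rw [hm] at this
      linarith [hT n]
    have hFM : ∀ z, F z ^ 2 ≤ M := fun z =>
      le_of_tendsto' ((hptw z).pow 2) fun n => hfM _ z
    have hrM : ∀ n z, r n z ^ 2 ≤ 4 * M := fun n z => by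
      have h1 := hFM z
      have h2 := hfM (φ n) z
      simp only [r]
      nlinarith [sq_nonneg (f (φ n) z + F z)]
    have h1 : Tendsto (fun n => ∫ z, f (φ n) z ^ 4 ∂nu - ∫ z, r n z ^ 4 ∂nu - ∫ z, F z ^ 4 ∂nu)
        atTop (𝓝 0) := by
      have h2 := hcross.const_mul (35 * M)
      rw [mul_zero] at h2
      refine squeeze_zero_norm (fun n => ?_) h2
      have hs : Integrable (fun z => f (φ n) z ^ 4 - r n z ^ 4) nu :=
        (hg _).int4.sub (hr n).int4
      have hs2 : Integrable (fun z => f (φ n) z ^ 4 - r n z ^ 4 - F z ^ 4) nu :=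
        hs.sub hF.int4
      rw [← integral_sub (hg _).int4 (hr n).int4,
        ← integral_sub hs hF.int4, ← integral_const_mul]
      refine (norm_integral_le_integral_norm _).trans ?_
      refine integral_mono hs2.norm
        ((hFr n).abs.const_mul _) fun z => ?_
      simp only
      have h3 : f (φ n) z = F z + r n z := by simp only [r]; ring
      rw [h3, show (F z + r n z) ^ 4 - r n z ^ 4 - F z ^ 4 =
        (4 * F z ^ 2 + 6 * (F z * r n z) + 4 * r n z ^ 2) * (F z * r n z) by ring,
        Real.norm_eq_abs, abs_mul]
      refine mul_le_mul_of_nonneg_right ?_ (abs_nonneg _)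
      have h4 := hFM z
      have h5 := hrM n z
      rw [abs_le]
      constructor <;> nlinarith [sq_nonneg (F z + r n z), sq_nonneg (F z - r n z)]
    have h2 := h1.add_const (∫ z, F z ^ 4 ∂nu)
    rw [zero_add] at h2
    exact h2.congr fun n => by ring
  have hEr : Tendsto (fun n => En (r n) (e n)) atTop (𝓝 (I - En F D)) := by
    have h1 := hElim'.sub ((hkin.const_mul (1 / 2)).sub (hpot.const_mul (1 / 4)))
    refine h1.congr fun n => ?_
    simp only [En]
    ring
  have hlow : (μ - m) / μ * I ≤ I - En F D := by
    refine le_of_tendsto_of_tendsto ((hmass.div_const μ).mul_const I) hEr ?_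
    filter_upwards [hmass.eventually (gt_mem_nhds (show μ - m < μ by linarith))] with n hn
    exact low hμ hI (hr n) hn.le
  have hsc := scaled hμ hI hF hmpos
  rw [← hmdef] at hsc
  have hEF : En F D ≤ m / μ * I := by
    have : (μ - m) / μ * I = I - m / μ * I := by field_simp
    linarith
  have hge : μ ≤ m := by
    by_contra hlt
    have h1 : 1 < μ / m := by rw [one_lt_div hmpos]; exact not_le.1 hlt
    simp only [En] at hEF
    nlinarith
  have hmeq : m = μ := le_antisymm hFle hge
  refine ⟨F, D, hF, hmeq, fun g e' hg' hm' => ?_⟩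
  rw [hmeq, div_self hμ.ne', one_mul] at hEF
  exact hEF.trans (hI _ _ hg' hm')

end GridAux
end

open MeasureTheory Filter Topology
open scoped ENNReal NNReal
noncomputable section
namespace GridAux

lemma critMass_four (K : ℝ) : critMass 4 K = 2 / K := by
  unfold critMass
  rw [show (2:ℝ) / (4 - 2) = 1 by norm_num, Real.rpow_one, show (4:ℝ) = 2 * 2 by norm_num,
    mul_div_mul_left _ _ (by norm_num)]

lemma gnQuot_eq {u : GridFunc} (hu : u.MemH1) : u.gnQuot 4 =
    (∫ z, glue u.h u.w z ^ 4 ∂nu) /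
      ((∫ z, glue u.h u.w z ^ 2 ∂nu) * ∫ z, glue u.hd u.wd z ^ 2 ∂nu) := by
  unfold GridFunc.gnQuot
  rw [show ((4:ℝ) - 2) / 2 = 1 by norm_num, Real.rpow_one, mass_eq hu, kin_eq hu, pot_eq hu]

lemma nonzero_of_glue {u : GridFunc} {z : Om} (hz : glue u.h u.w z ≠ 0) : u.Nonzero := by
  obtain ⟨⟨_ | _, j⟩, x⟩ := z
  · exact Or.inl ⟨j, x, hz⟩
  · exact Or.inr ⟨j, x, hz⟩

/-- The optimal constant bounds every quotient. -/
lemma gn {K : ℝ} (hK : IsLUB (gnSet 4) K) {f d : Om → ℝ} (h : Good f d)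
    (hm : 0 < ∫ z, f z ^ 2 ∂nu) :
    ∫ z, f z ^ 4 ∂nu ≤ K * ((∫ z, f z ^ 2 ∂nu) * ∫ z, d z ^ 2 ∂nu) := by
  obtain ⟨u, hu, rfl, rfl⟩ := exists_of_good h
  have hnz : ∃ z, glue u.h u.w z ≠ 0 := by
    by_contra hcon
    push Not at hcon
    simp [hcon] at hm
  obtain ⟨z, hz⟩ := hnz
  have h1 := hK.1 ⟨u, hu, nonzero_of_glue hz, rfl⟩
  rw [gnQuot_eq hu, div_le_iff₀ (mul_pos hm (h.deriv_pos hm))] at h1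
  exact h1

lemma K_pos {K : ℝ} (hK : IsLUB (gnSet 4) K) : 0 < K := by
  have h := good_test one_pos
  have hm := test_mass_pos one_pos
  have h1 := gn hK h hm
  have h4 : 0 < ∫ z, tf 1 z ^ 4 ∂nu :=
    h.int_pow_pos (z := ((false, 0), 0)) (Real.exp_pos _).ne' (by decide) h.int4
  have h2 := mul_pos hm (h.deriv_pos hm)
  by_contra hcon
  have := mul_nonpos_of_nonpos_of_nonneg (not_lt.1 hcon) h2.le
  linarith

end GridAux
end

noncomputable section

/-- **Dimensional crossover, part (ii) (Theorem 1.2(ii))**: for `p = 4` and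
`μ > 0`, with `K_4` the optimal Gagliardo–Nirenberg constant and
`μ_4 = (4/(2K_4))^{2/(4−2)} = 2/K_4` the critical mass, a ground state of
mass `μ` exists whenever `μ > μ_4`, and no ground state of mass `μ` exists
whenever `μ < μ_4`. -/
theorem grid_crossover_ii (K μ : ℝ) (hK : IsLUB (gnSet 4) K) (hμ : 0 < μ) :
    (critMass 4 K < μ → ∃ u : GridFunc, IsGroundState 4 μ u) ∧
    (μ < critMass 4 K → ¬ ∃ u : GridFunc, IsGroundState 4 μ u) := by
  have hK0 := GridAux.K_pos hK
  rw [GridAux.critMass_four]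
  constructor
  · intro hlt
    have h1 : 2 / μ < K := by
      rw [div_lt_iff₀ hK0] at hlt
      rw [div_lt_iff₀ hμ]
      linarith
    obtain ⟨q, ⟨v, hv, -, rfl⟩, hq, -⟩ := hK.exists_between h1
    rw [GridAux.gnQuot_eq hv] at hq
    have hgood := GridAux.good_of_memH1 hv
    have hneg : ∃ f d, GridAux.Good f d ∧ ∫ z, f z ^ 2 ∂GridAux.nu = μ ∧ GridAux.En f d < 0 := by
      set f := GridAux.glue v.h v.w
      set d := GridAux.glue v.hd v.wd
      set m := ∫ z, f z ^ 2 ∂GridAux.nu with hmdef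
      set T := ∫ z, d z ^ 2 ∂GridAux.nu with hTdef
      set Q := ∫ z, f z ^ 4 ∂GridAux.nu with hQdef
      have hm0 : 0 ≤ m := integral_nonneg fun z => sq_nonneg _
      have hT0 : 0 ≤ T := integral_nonneg fun z => sq_nonneg _
      have hmT : 0 < m * T := by
        refine lt_of_le_of_ne (by positivity) fun h0 => ?_
        rw [← h0, div_zero] at hq
        have : 0 < 2 / μ := by positivity
        linarith
      have hm : 0 < m := pos_of_mul_pos_left hmT hT0
      have hT : 0 < T := pos_of_mul_pos_right hmT hm0
      rw [div_lt_div_iff₀ hμ hmT] at hq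
      have hc2 : Real.sqrt (μ / m) ^ 2 = μ / m := Real.sq_sqrt (by positivity)
      have hc4 : Real.sqrt (μ / m) ^ 4 = (μ / m) ^ 2 := by
        rw [show Real.sqrt (μ / m) ^ 4 = (Real.sqrt (μ / m) ^ 2) ^ 2 by ring, hc2]
      refine ⟨_, _, hgood.smul (Real.sqrt (μ / m)), ?_, ?_⟩
      · simp only [mul_pow, integral_const_mul]
        rw [hc2, ← hmdef]; field_simp
      · rw [GridAux.Good.En_smul, hc2, hc4, ← hTdef, ← hQdef]
        have h2 : 1 / 2 * (μ / m * T) - 1 / 4 * ((μ / m) ^ 2 * Q) =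
          (μ / (4 * m ^ 2)) * (2 * (m * T) - Q * μ) := by field_simp; ring
        rw [h2]
        exact mul_neg_of_pos_of_neg (by positivity) (by linarith)
    obtain ⟨f, d, hfd, hm, hmin⟩ := GridAux.exists_min hμ hneg
    obtain ⟨u, hu, rfl, rfl⟩ := GridAux.exists_of_good hfd
    refine ⟨u, hu, (GridAux.mass_eq hu).trans hm, fun w hw hwm => ?_⟩
    rw [GridAux.energy_eq hu, GridAux.energy_eq hw]
    exact hmin _ _ (GridAux.good_of_memH1 hw) ((GridAux.mass_eq hw).symm.trans hwm)
  · rintro hlt ⟨u, hu, hm, hmin⟩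
    have hgood := GridAux.good_of_memH1 hu
    have hm' : ∫ z, GridAux.glue u.h u.w z ^ 2 ∂GridAux.nu = μ := (GridAux.mass_eq hu).symm.trans hm
    have hgn := GridAux.gn hK hgood (hm' ▸ hμ)
    have hT := hgood.deriv_pos (hm' ▸ hμ)
    rw [hm'] at hgn
    rw [lt_div_iff₀ hK0] at hlt
    have hpos : 0 < u.energy 4 := by
      rw [GridAux.energy_eq hu, GridAux.En]
      nlinarith
    obtain ⟨f, d, hfd, hfm, hE⟩ := GridAux.small_energy hμ hpos
    obtain ⟨v, hv, rfl, rfl⟩ := GridAux.exists_of_good hfd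
    have := hmin v hv ((GridAux.mass_eq hv).trans hfm)
    rw [GridAux.energy_eq hv] at this
    linarith

end
end
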